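/- Let S ⊂ ℤ be a finite nonempty set satisfying S = −S and such that s+t ∉ S for all s,t ∈ ℕ∖S. If 0 ∈ S, then there exists a nonzero polynomial P with rational coefficients in three variables such that P(F_S(x,u), e^x, u) = 0 in ℚ[u][[x]]; moreover F_S is the unique formal power series solution of this equation, and consequently F_S(x,u) = F̂(e^x − 1, u) for an algebraic formal power series F̂. If 0 ∉ S, then there exists a nonzero polynomial P with rational coefficients in four variables such that P(F_S(x,u), e^{xu}, e^x, u) = 0 in ℚ[u][[x]], and F_S is the unique formal power series solution of this equation. -/

import Mathlib

open scoped BigOperators Classical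

namespace Braid

def hyp (n : ℕ) (i j : Fin n) (s : ℝ) : Set (Fin n → ℝ) := {x | x i - x j = s}
def arrS (S : Set ℤ) (n : ℕ) : Set (Set (Fin n → ℝ)) :=
  {H | ∃ i j : Fin n, ∃ s : ℤ, i < j ∧ s ∈ S ∧ H = hyp n i j (s : ℝ)}
def IsSideOf (n : ℕ) (σ H : Set (Fin n → ℝ)) : Prop :=
  σ = H ∨ ∃ (i j : Fin n) (s : ℝ), H = hyp n i j s ∧
    (σ = {x | x i - x j < s} ∨ σ = {x | s < x i - x j})
def IsFace (n : ℕ) (A : Set (Set (Fin n → ℝ))) (F : Set (Fin n → ℝ)) : Prop :=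
  F.Nonempty ∧ ∃ σ : Set (Fin n → ℝ) → Set (Fin n → ℝ),
    (∀ H ∈ A, IsSideOf n (σ H) H) ∧ F = ⋂ H ∈ A, σ H
noncomputable def faceDim (n : ℕ) (F : Set (Fin n → ℝ)) : ℕ :=
  Module.finrank ℝ (affineSpan ℝ F).direction

/-- The number `c_{n,k}` of `k`-dimensional faces of `A_S^n`. -/
noncomputable def faceCount (S : Set ℤ) (n k : ℕ) : ℕ :=
  Nat.card {F : Set (Fin n → ℝ) // IsFace n (arrS S n) F ∧ faceDim n F = k}

/-- The face generating function `F_S(x,u) ∈ ℚ[u][[x]]`. -/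
noncomputable def FGF (S : Set ℤ) : PowerSeries (Polynomial ℚ) :=
  PowerSeries.mk fun n => Polynomial.C ((n.factorial : ℚ)⁻¹) *
    ∑ k ∈ Finset.range (n + 1), (faceCount S n k : ℚ) • Polynomial.X ^ k

/-- `e^x` in `ℚ[u][[x]]`. -/
noncomputable def Eexp : PowerSeries (Polynomial ℚ) :=
  PowerSeries.mk fun n => Polynomial.C ((n.factorial : ℚ)⁻¹)

/-- `e^{-x}` in `ℚ[u][[x]]`. -/
noncomputable def EexpNeg : PowerSeries (Polynomial ℚ) :=
  PowerSeries.mk fun n => Polynomial.C ((-1 : ℚ) ^ n * (n.factorial : ℚ)⁻¹)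

/-- The variable `u` as an element of `ℚ[u][[x]]`. -/
noncomputable def Useries : PowerSeries (Polynomial ℚ) := PowerSeries.C Polynomial.X

/-- `e^{xu}` in `ℚ[u][[x]]`. -/
noncomputable def Eexu : PowerSeries (Polynomial ℚ) :=
  PowerSeries.mk fun n => ((n.factorial : ℚ)⁻¹) • Polynomial.X ^ n

/-- `e^{-xu}` in `ℚ[u][[x]]`. -/
noncomputable def EexuNeg : PowerSeries (Polynomial ℚ) :=
  PowerSeries.mk fun n => ((-1 : ℚ) ^ n * (n.factorial : ℚ)⁻¹) • Polynomial.X ^ n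

/-- Substitution `G(a, u)` of a power series `a` (with zero constant term) for the first
variable of `G ∈ ℚ[u][[t]]`, defined coefficientwise:
the coefficient of `x^n` is `Σ_{k ≤ n} ([t^k] G) · [x^n](a^k)`. -/
noncomputable def compPS (G a : PowerSeries (Polynomial ℚ)) : PowerSeries (Polynomial ℚ) :=
  PowerSeries.mk fun n => ∑ k ∈ Finset.range (n + 1),
    PowerSeries.coeff k G * PowerSeries.coeff n (a ^ k)

section AlgSystem
variable {St : Type} (m : ℕ) (nw tr : St → ℕ → St) (s0 : St)

/-- one step of the finite system -/
noncomputable def sysStep (o : St → PowerSeries (Polynomial ℚ)) (t G : PowerSeries (Polynomial ℚ))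
    (z : St → PowerSeries (Polynomial ℚ)) (σ : St) : PowerSeries (Polynomial ℚ) :=
  o σ * (1 + ∑ δ ∈ Finset.range (m + 1), G ^ δ * z (nw σ δ)) +
    t * ∑ δ ∈ Finset.Ico 1 (m + 1), G ^ δ * z (tr σ δ)

/-- the infinite recursion -/
noncomputable def ysys (o : St → PowerSeries (Polynomial ℚ)) (t : PowerSeries (Polynomial ℚ)) :
    ℕ → St → ℕ → PowerSeries (Polynomial ℚ)
  | 0, _, _ => 0
  | N + 1, σ, c => o σ * (1 + ∑ b ∈ Finset.range c, ysys o t N s0 b +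
      ∑ δ ∈ Finset.range (m + 1), ysys o t N (nw σ δ) (c + δ)) +
      t * ∑ δ ∈ Finset.Ico 1 (m + 1), ysys o t N (tr σ δ) (c + δ)

noncomputable def zsys (o : St → PowerSeries (Polynomial ℚ)) (t : PowerSeries (Polynomial ℚ)) :
    ℕ → St → PowerSeries (Polynomial ℚ)
  | 0 => fun _ => 0
  | N + 1 => sysStep m nw tr o t (1 + zsys o t N s0) (zsys o t N)

lemma sysStep_contr (o : St → PowerSeries (Polynomial ℚ)) (t : PowerSeries (Polynomial ℚ))
    (ho : ∀ σ, PowerSeries.X ∣ o σ) (ht : PowerSeries.X ∣ t)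
    (a b : St → PowerSeries (Polynomial ℚ)) (N : ℕ)
    (h : ∀ σ, (PowerSeries.X : PowerSeries (Polynomial ℚ)) ^ N ∣ a σ - b σ) (σ : St) :
    (PowerSeries.X : PowerSeries (Polynomial ℚ)) ^ (N + 1) ∣
      sysStep m nw tr o t (1 + a s0) a σ - sysStep m nw tr o t (1 + b s0) b σ := by
  have hp : ∀ δ τ, (PowerSeries.X : PowerSeries (Polynomial ℚ)) ^ N ∣
      (1 + a s0) ^ δ * a τ - (1 + b s0) ^ δ * b τ := by
    intro δ τ
    have h1 : (PowerSeries.X : PowerSeries (Polynomial ℚ)) ^ N ∣ (1 + a s0) ^ δ - (1 + b s0) ^ δ :=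
      dvd_trans (by simpa using h s0) (sub_dvd_pow_sub_pow (1 + a s0) (1 + b s0) δ)
    have : (1 + a s0) ^ δ * a τ - (1 + b s0) ^ δ * b τ =
      ((1 + a s0) ^ δ - (1 + b s0) ^ δ) * a τ + (1 + b s0) ^ δ * (a τ - b τ) := by ring
    rw [this]
    exact dvd_add (Dvd.dvd.mul_right h1 _) (Dvd.dvd.mul_left (h τ) _)
  have e : sysStep m nw tr o t (1 + a s0) a σ - sysStep m nw tr o t (1 + b s0) b σ =
      o σ * ∑ δ ∈ Finset.range (m + 1), ((1 + a s0) ^ δ * a (nw σ δ) - (1 + b s0) ^ δ * b (nw σ δ)) +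
      t * ∑ δ ∈ Finset.Ico 1 (m + 1), ((1 + a s0) ^ δ * a (tr σ δ) - (1 + b s0) ^ δ * b (tr σ δ)) := by
    unfold sysStep
    rw [Finset.sum_sub_distrib, Finset.sum_sub_distrib]
    ring
  rw [e, pow_succ']
  exact dvd_add (mul_dvd_mul (ho σ) (Finset.dvd_sum fun δ _ => hp _ _))
    (mul_dvd_mul ht (Finset.dvd_sum fun δ _ => hp _ _))

lemma eq_of_forall_X_pow_dvd {R : Type*} [CommRing R] {a b : PowerSeries R}
    (h : ∀ N, (PowerSeries.X : PowerSeries R) ^ N ∣ a - b) : a = b := by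
  ext n
  have := (PowerSeries.X_pow_dvd_iff.1 (h (n + 1))) n (Nat.lt_succ_self n)
  rwa [map_sub, sub_eq_zero] at this

lemma zsys_exists (o : St → PowerSeries (Polynomial ℚ)) (t : PowerSeries (Polynomial ℚ))
    (ho : ∀ σ, PowerSeries.X ∣ o σ) (ht : PowerSeries.X ∣ t) :
    ∃ V : St → PowerSeries (Polynomial ℚ), V = sysStep m nw tr o t (1 + V s0) V ∧
      ∀ V' : St → PowerSeries (Polynomial ℚ), V' = sysStep m nw tr o t (1 + V' s0) V' → V' = V := by
  set z := zsys m nw tr s0 o t with hz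
  have hzs : ∀ N, z (N + 1) = sysStep m nw tr o t (1 + z N s0) (z N) := fun N => rfl
  have h1 : ∀ N σ, (PowerSeries.X : PowerSeries (Polynomial ℚ)) ^ N ∣ z (N + 1) σ - z N σ := by
    intro N
    induction N with
    | zero => intro σ; simp
    | succ N ih =>
      intro σ
      rw [hzs (N + 1), hzs N]
      have := sysStep_contr m nw tr s0 o t ho ht (z (N + 1)) (z N) N ih σ
      rwa [hzs N] at this
  have h2 : ∀ N k σ, (PowerSeries.X : PowerSeries (Polynomial ℚ)) ^ N ∣ z (N + k) σ - z N σ := by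
    intro N k σ
    induction k with
    | zero => simp
    | succ k ih =>
      have := dvd_add (dvd_trans (pow_dvd_pow _ (Nat.le_add_right N k)) (h1 (N + k) σ)) ih
      rw [sub_add_sub_cancel] at this
      exact this
  let V : St → PowerSeries (Polynomial ℚ) := fun σ =>
    PowerSeries.mk fun n => PowerSeries.coeff n (z (n + 1) σ)
  have hV : ∀ N σ, (PowerSeries.X : PowerSeries (Polynomial ℚ)) ^ N ∣ V σ - z N σ := by
    intro N σ
    rw [PowerSeries.X_pow_dvd_iff]
    intro n hn
    obtain ⟨k, rfl⟩ := Nat.exists_eq_add_of_lt hn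
    have := (PowerSeries.X_pow_dvd_iff.1 (h2 (n + 1) k σ)) n (Nat.lt_succ_self n)
    rw [map_sub, sub_eq_zero] at this ⊢
    rw [show n + k + 1 = n + 1 + k by ring, this]
    simp [V]
  have hVf : V = sysStep m nw tr o t (1 + V s0) V := by
    funext σ
    apply eq_of_forall_X_pow_dvd
    intro N
    have a1 := hV (N + 1) σ
    have a2 := sysStep_contr m nw tr s0 o t ho ht V (z N) N (hV N) σ
    rw [← hzs N] at a2
    have := dvd_sub a1 a2
    rw [sub_sub_sub_cancel_right] at this
    exact dvd_trans (pow_dvd_pow _ (Nat.le_succ N)) this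
  refine ⟨V, hVf, ?_⟩
  intro V' hV'
  have : ∀ N σ, (PowerSeries.X : PowerSeries (Polynomial ℚ)) ^ N ∣ V' σ - V σ := by
    intro N
    induction N with
    | zero => intro σ; simp
    | succ N ih =>
      intro σ
      rw [hV', hVf]
      exact sysStep_contr m nw tr s0 o t ho ht V' V N ih σ
  funext σ
  exact eq_of_forall_X_pow_dvd fun N => this N σ

lemma ysys_approx (o : St → PowerSeries (Polynomial ℚ)) (t : PowerSeries (Polynomial ℚ))
    (ho : ∀ σ, PowerSeries.X ∣ o σ) (ht : PowerSeries.X ∣ t)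
    (V : St → PowerSeries (Polynomial ℚ)) (hV : V = sysStep m nw tr o t (1 + V s0) V) (N : ℕ) :
    ∀ σ c, (PowerSeries.X : PowerSeries (Polynomial ℚ)) ^ N ∣
      (1 + V s0) ^ c * V σ - ysys m nw tr s0 o t N σ c := by
  induction N with
  | zero => intro σ c; simp
  | succ N ih =>
    intro σ c
    have geo : (1 + V s0) ^ c = 1 + ∑ b ∈ Finset.range c, (1 + V s0) ^ b * V s0 := by
      have := geom_sum_mul (1 + V s0) c
      rw [← Finset.sum_mul]
      rw [show (1 + V s0 - 1) = V s0 by ring] at this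
      rw [this]; ring
    have e : (1 + V s0) ^ c * V σ - ysys m nw tr s0 o t (N + 1) σ c =
      o σ * (∑ b ∈ Finset.range c, ((1 + V s0) ^ b * V s0 - ysys m nw tr s0 o t N s0 b) +
        ∑ δ ∈ Finset.range (m + 1), ((1 + V s0) ^ (c + δ) * V (nw σ δ) -
          ysys m nw tr s0 o t N (nw σ δ) (c + δ))) +
      t * ∑ δ ∈ Finset.Ico 1 (m + 1), ((1 + V s0) ^ (c + δ) * V (tr σ δ) -
          ysys m nw tr s0 o t N (tr σ δ) (c + δ)) := by
      have h1 : V σ = sysStep m nw tr o t (1 + V s0) V σ := congrFun hV σ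
      rw [h1, ysys]
      unfold sysStep
      simp only [Finset.sum_sub_distrib, pow_add, mul_assoc, ← Finset.mul_sum]
      linear_combination (o σ) * geo
    rw [e, pow_succ']
    refine dvd_add (mul_dvd_mul (ho σ) (dvd_add ?_ ?_)) (mul_dvd_mul ht ?_)
    all_goals exact Finset.dvd_sum fun δ _ => ih _ _


noncomputable def sysMat (op : St → MvPolynomial (Fin 4) ℚ) :
    Matrix St St (MvPolynomial (Fin 4) ℚ) := fun σ τ =>
  op σ * ∑ δ ∈ Finset.range (m + 1), (if nw σ δ = τ then MvPolynomial.X 0 ^ δ else 0) +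
    MvPolynomial.X 1 * ∑ δ ∈ Finset.Ico 1 (m + 1),
      (if tr σ δ = τ then MvPolynomial.X 0 ^ δ else 0)

noncomputable def sysPoly [Fintype St] (op : St → MvPolynomial (Fin 4) ℚ) : MvPolynomial (Fin 4) ℚ :=
  (1 - sysMat m nw tr op).det * (MvPolynomial.X 0 - 1) -
    ((1 - sysMat m nw tr op).adjugate.mulVec op) s0

theorem sysPoly_spec [Fintype St] (op : St → MvPolynomial (Fin 4) ℚ)
    (o : St → PowerSeries (Polynomial ℚ)) (t w U : PowerSeries (Polynomial ℚ))
    (hop : ∀ G σ, MvPolynomial.aeval ![G, t, w, U] (op σ) = o σ)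
    (ho : ∀ σ, PowerSeries.X ∣ o σ) (ht : PowerSeries.X ∣ t) (F : PowerSeries (Polynomial ℚ))
    (hF : ∀ N n, n < N → PowerSeries.coeff n F =
      PowerSeries.coeff n (1 + ysys m nw tr s0 o t N s0 0)) :
    MvPolynomial.aeval ![F, t, w, U] (sysPoly m nw tr s0 op) = 0 ∧
    ∀ G, MvPolynomial.aeval ![G, t, w, U] (sysPoly m nw tr s0 op) = 0 → G = F := by
  obtain ⟨V, hV, hVu⟩ := zsys_exists m nw tr s0 o t ho ht
  have hFV : F = 1 + V s0 := by
    ext1 n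
    rw [hF (n + 1) n (Nat.lt_succ_self n)]
    have h1 := ysys_approx m nw tr s0 o t ho ht V hV (n + 1) s0 0
    have h2 := (PowerSeries.X_pow_dvd_iff.1 h1) n (Nat.lt_succ_self n)
    rw [pow_zero, one_mul, map_sub, sub_eq_zero] at h2
    rw [map_add, map_add, h2]
  let NG : PowerSeries (Polynomial ℚ) → Matrix St St (PowerSeries (Polynomial ℚ)) := fun G =>
    (sysMat m nw tr op).map (MvPolynomial.aeval (R := ℚ) ![G, t, w, U])
  have hNGe : ∀ G σ τ, NG G σ τ = o σ * ∑ δ ∈ Finset.range (m + 1), (if nw σ δ = τ then G ^ δ else 0) +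
      t * ∑ δ ∈ Finset.Ico 1 (m + 1), (if tr σ δ = τ then G ^ δ else 0) := by
    intro G σ τ
    simp only [NG, Matrix.map_apply, sysMat, map_add, map_mul, map_sum, hop, MvPolynomial.aeval_X]
    simp [apply_ite (MvPolynomial.aeval (R := ℚ) ![G, t, w, U])]
  have hNV : ∀ G (z : St → PowerSeries (Polynomial ℚ)), o + (NG G).mulVec z = sysStep m nw tr o t G z := by
    intro G z
    funext σ
    simp only [Pi.add_apply, Matrix.mulVec, dotProduct, hNGe, sysStep]
    have e1 : ∀ (s : Finset ℕ) (f : ℕ → St), ∑ τ, (∑ δ ∈ s, (if f δ = τ then G ^ δ else 0)) * z τ =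
        ∑ δ ∈ s, G ^ δ * z (f δ) := by
      intro s f
      simp only [Finset.sum_mul]
      rw [Finset.sum_comm]
      refine Finset.sum_congr rfl fun δ _ => ?_
      simp
    simp only [add_mul, mul_assoc, Finset.sum_add_distrib, ← Finset.mul_sum, e1]
    ring
  have hae : ∀ G, MvPolynomial.aeval ![G, t, w, U] (sysPoly m nw tr s0 op) =
      (1 - NG G).det * (G - 1) - ((1 - NG G).adjugate.mulVec o) s0 := by
    intro G
    have h1 : (1 - sysMat m nw tr op).map (MvPolynomial.aeval (R := ℚ) ![G, t, w, U]) = 1 - NG G := by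
      ext σ τ
      simp [NG, Matrix.map_apply, Matrix.one_apply, apply_ite (MvPolynomial.aeval (R := ℚ) ![G, t, w, U])]
    have h2 : MvPolynomial.aeval ![G, t, w, U] (1 - sysMat m nw tr op).det = (1 - NG G).det := by
      rw [← h1]
      exact AlgHom.map_det (MvPolynomial.aeval (R := ℚ) ![G, t, w, U]) _
    have h3 : ((1 - sysMat m nw tr op).adjugate).map (MvPolynomial.aeval (R := ℚ) ![G, t, w, U]) =
        (1 - NG G).adjugate := by
      rw [← h1]
      exact AlgHom.map_adjugate (MvPolynomial.aeval (R := ℚ) ![G, t, w, U]) _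
    unfold sysPoly
    rw [map_sub, map_mul, h2, map_sub, map_one, MvPolynomial.aeval_X]
    congr 1
    rw [← h3]
    simp only [Matrix.mulVec, dotProduct, map_sum, map_mul, Matrix.map_apply, hop]
  have hroot : ∀ G (z : St → PowerSeries (Polynomial ℚ)), z = sysStep m nw tr o t G z →
      (1 - NG G).adjugate.mulVec o = (1 - NG G).det • z := by
    intro G z hz
    have : o = (1 - NG G).mulVec z := by
      rw [Matrix.sub_mulVec, Matrix.one_mulVec]
      rw [← hNV] at hz
      exact (sub_eq_of_eq_add hz).symm
    rw [this, Matrix.mulVec_mulVec, Matrix.adjugate_mul, Matrix.smul_mulVec, Matrix.one_mulVec]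
  constructor
  · rw [hae, hroot F V (by rw [hFV]; exact hV), hFV]
    simp
  · intro G hG
    rw [hae] at hG
    have hdet : IsUnit (1 - NG G).det := by
      rw [PowerSeries.isUnit_iff_constantCoeff]
      have : PowerSeries.constantCoeff (1 - NG G).det = 1 := by
        rw [RingHom.map_det]
        have : (PowerSeries.constantCoeff (R := Polynomial ℚ)).mapMatrix (1 - NG G) = 1 := by
          ext1 σ τ
          have h1 : PowerSeries.constantCoeff (NG G σ τ) = 0 := by
            rw [hNGe, map_add, map_mul, map_mul, PowerSeries.X_dvd_iff.1 (ho σ), PowerSeries.X_dvd_iff.1 ht]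
            simp
          rw [RingHom.mapMatrix_apply, Matrix.map_apply, Matrix.sub_apply, map_sub, h1]
          simp [Matrix.one_apply, apply_ite]
        rw [this, Matrix.det_one]
      rw [this]; exact isUnit_one
    obtain ⟨d, hd⟩ := hdet.exists_left_inv
    set z : St → PowerSeries (Polynomial ℚ) := d • (1 - NG G).adjugate.mulVec o with hz
    have hzG : 1 + z s0 = G := by
      rw [hz, Pi.smul_apply, smul_eq_mul, ← sub_eq_zero.1 hG, ← mul_assoc, hd]
      ring
    have hzs : z = sysStep m nw tr o t (1 + z s0) z := by
      rw [hzG, ← hNV]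
      have : (1 - NG G).mulVec z = o := by
        rw [hz, Matrix.mulVec_smul, Matrix.mulVec_mulVec, Matrix.mul_adjugate, Matrix.smul_mulVec,
          Matrix.one_mulVec, smul_smul, hd, one_smul]
      rw [Matrix.sub_mulVec, Matrix.one_mulVec] at this
      rw [← this]; simp
    rw [← hzG, hVu z hzs, hFV]

end AlgSystem

noncomputable def fhatCoeff (F a : PowerSeries (Polynomial ℚ)) : ℕ → Polynomial ℚ
  | n => PowerSeries.coeff n F - ∑ k : Fin n, fhatCoeff F a k.1 * PowerSeries.coeff n (a ^ k.1)
  termination_by n => n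
  decreasing_by exact k.2

lemma coeff_pow_self (a : PowerSeries (Polynomial ℚ)) (h0 : PowerSeries.constantCoeff a = 0)
    (h1 : PowerSeries.coeff 1 a = 1) (n : ℕ) : PowerSeries.coeff n (a ^ n) = 1 := by
  obtain ⟨b, rfl⟩ := PowerSeries.X_dvd_iff.2 h0
  rw [mul_pow]
  have := PowerSeries.coeff_X_pow_mul (b ^ n) n 0
  rw [zero_add] at this
  rw [this, PowerSeries.coeff_zero_eq_constantCoeff_apply, map_pow]
  have h2 := PowerSeries.coeff_succ_X_mul 0 b
  rw [zero_add, h1, PowerSeries.coeff_zero_eq_constantCoeff_apply] at h2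
  rw [← h2, one_pow]

lemma coeff_pow_zero_of_lt (a : PowerSeries (Polynomial ℚ)) (h0 : PowerSeries.constantCoeff a = 0)
    {n k : ℕ} (h : n < k) : PowerSeries.coeff n (a ^ k) = 0 := by
  have := pow_dvd_pow_of_dvd (PowerSeries.X_dvd_iff.2 h0) k
  exact PowerSeries.X_pow_dvd_iff.1 this n h

lemma compPS_fhat (F a : PowerSeries (Polynomial ℚ)) (h0 : PowerSeries.constantCoeff a = 0)
    (h1 : PowerSeries.coeff 1 a = 1) : F = compPS (PowerSeries.mk (fhatCoeff F a)) a := by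
  ext1 n
  simp only [compPS, PowerSeries.coeff_mk]
  rw [Finset.sum_range_succ, coeff_pow_self a h0 h1, mul_one, Finset.sum_range]
  rw [fhatCoeff.eq_1 F a n]
  ring

lemma compPS_eq_subst (G a : PowerSeries (Polynomial ℚ)) (h0 : PowerSeries.constantCoeff a = 0) :
    compPS G a = PowerSeries.subst a G := by
  ext1 n
  rw [PowerSeries.coeff_subst' (PowerSeries.HasSubst.of_constantCoeff_zero' h0)]
  simp only [compPS, PowerSeries.coeff_mk]
  symm
  rw [finsum_eq_sum_of_support_subset (s := Finset.range (n + 1))]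
  · simp [smul_eq_mul]
  · intro k hk
    simp only [Function.mem_support, smul_eq_mul] at hk
    simp only [Finset.coe_range, Set.mem_Iio]
    by_contra hlt
    exact hk (by rw [coeff_pow_zero_of_lt a h0 (by omega), mul_zero])

lemma compPS_inj (a : PowerSeries (Polynomial ℚ)) (h0 : PowerSeries.constantCoeff a = 0)
    (h1 : PowerSeries.coeff 1 a = 1) (G : PowerSeries (Polynomial ℚ)) (h : compPS G a = 0) : G = 0 := by
  ext1 n
  induction n using Nat.strong_induction_on with
  | _ n ih =>
    have := congrArg (PowerSeries.coeff n) h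
    simp only [compPS, PowerSeries.coeff_mk] at this
    rw [Finset.sum_range_succ, coeff_pow_self a h0 h1, mul_one, Finset.sum_eq_zero] at this
    · simpa using this
    · intro k hk
      rw [ih k (Finset.mem_range.1 hk)]; simp

lemma Eexp_sub_one_const : PowerSeries.constantCoeff (Eexp - 1) = 0 := by
  rw [← PowerSeries.coeff_zero_eq_constantCoeff_apply]
  simp [Eexp]

lemma Eexp_sub_one_one : PowerSeries.coeff 1 (Eexp - 1) = 1 := by
  simp [Eexp, PowerSeries.coeff_one]

lemma Eexu_sub_one_const : PowerSeries.constantCoeff (Eexu - 1) = 0 := by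
  rw [← PowerSeries.coeff_zero_eq_constantCoeff_apply]
  simp [Eexu]

/-- weight of a singleton run -/
noncomputable def w1 (S : Set ℤ) : PowerSeries (Polynomial ℚ) :=
  if (0 : ℤ) ∈ S then Useries * (Eexp - 1) else Eexu - 1

lemma w1_const (S : Set ℤ) : PowerSeries.constantCoeff (w1 S) = 0 := by
  unfold w1
  split_ifs
  · rw [map_mul, Eexp_sub_one_const, mul_zero]
  · exact Eexu_sub_one_const

/-- output kinds: 0 none, 1 singleton, otherwise big -/
noncomputable def outP : Fin 3 → MvPolynomial (Fin 4) ℚ :=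
  ![0, MvPolynomial.X 2, MvPolynomial.X 3 * MvPolynomial.X 1]

noncomputable def outA (S : Set ℤ) : Fin 3 → PowerSeries (Polynomial ℚ) :=
  ![0, w1 S, Useries * (Eexp - 1)]

theorem final_algebra (S : Set ℤ) {St : Type} [Fintype St] (m : ℕ) (nw tr : St → ℕ → St) (s0 : St)
    (kind : St → Fin 3)
    (hF : ∀ N n, n < N → PowerSeries.coeff n (FGF S) =
      PowerSeries.coeff n (1 + ysys m nw tr s0 (fun σ => outA S (kind σ)) (Eexp - 1) N s0 0)) :
    ((0 : ℤ) ∈ S →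
      ∃ P : MvPolynomial (Fin 3) ℚ, P ≠ 0 ∧
        MvPolynomial.aeval ![FGF S, Eexp, Useries] P = 0 ∧
        (∀ G : PowerSeries (Polynomial ℚ),
          MvPolynomial.aeval ![G, Eexp, Useries] P = 0 → G = FGF S) ∧
        ∃ Fhat : PowerSeries (Polynomial ℚ),
          (∃ Q : MvPolynomial (Fin 3) ℚ, Q ≠ 0 ∧
            MvPolynomial.aeval ![Fhat, PowerSeries.X, Useries] Q = 0) ∧
          FGF S = compPS Fhat (Eexp - 1)) ∧
    ((0 : ℤ) ∉ S →
      ∃ P : MvPolynomial (Fin 4) ℚ, P ≠ 0 ∧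
        MvPolynomial.aeval ![FGF S, Eexu, Eexp, Useries] P = 0 ∧
        ∀ G : PowerSeries (Polynomial ℚ),
          MvPolynomial.aeval ![G, Eexu, Eexp, Useries] P = 0 → G = FGF S) := by
  have key := sysPoly_spec m nw tr s0 (fun σ => outP (kind σ)) (fun σ => outA S (kind σ))
    (Eexp - 1) (w1 S) Useries
    (by
      intro G σ
      generalize kind σ = k
      fin_cases k <;> simp [outP, outA])
    (by
      intro σ
      rw [PowerSeries.X_dvd_iff]
      generalize kind σ = k
      fin_cases k
      · simp [outA]
      · simpa [outA] using w1_const S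
      · simp only [outA]
        show PowerSeries.constantCoeff (Useries * (Eexp - 1)) = 0
        rw [map_mul, Eexp_sub_one_const, mul_zero])
    (PowerSeries.X_dvd_iff.2 Eexp_sub_one_const) (FGF S) hF
  generalize sysPoly m nw tr s0 (fun σ => outP (kind σ)) = P4 at key
  constructor
  · intro h0
    have hw : w1 S = Useries * (Eexp - 1) := if_pos h0
    rw [hw] at key
    let P : MvPolynomial (Fin 3) ℚ := MvPolynomial.aeval ![MvPolynomial.X 0, MvPolynomial.X 1 - 1,
      MvPolynomial.X 2 * (MvPolynomial.X 1 - 1), MvPolynomial.X 2] P4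
    have hP : ∀ G, MvPolynomial.aeval ![G, Eexp, Useries] P =
        MvPolynomial.aeval ![G, Eexp - 1, Useries * (Eexp - 1), Useries] P4 := by
      intro G
      simp only [P, MvPolynomial.aeval_def, ← MvPolynomial.coe_eval₂Hom]
      rw [← RingHom.comp_apply]
      congr 1
      apply MvPolynomial.ringHom_ext
      · intro r; simp
      · intro i
        fin_cases i <;> simp
    have hroot : MvPolynomial.aeval ![FGF S, Eexp, Useries] P = 0 := by rw [hP]; exact key.1
    have huniq : ∀ G : PowerSeries (Polynomial ℚ),
          MvPolynomial.aeval ![G, Eexp, Useries] P = 0 → G = FGF S := by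
      intro G hG
      rw [hP] at hG
      exact key.2 G hG
    have hP0 : P ≠ 0 := by
      intro h
      have a := huniq 0 (by rw [h]; simp)
      have b := huniq 1 (by rw [h]; simp)
      exact zero_ne_one (a.trans b.symm)
    refine ⟨P, hP0, hroot, huniq, PowerSeries.mk (fhatCoeff (FGF S) (Eexp - 1)), ?_,
      compPS_fhat _ _ Eexp_sub_one_const Eexp_sub_one_one⟩
    let Q : MvPolynomial (Fin 3) ℚ := MvPolynomial.aeval ![MvPolynomial.X 0, MvPolynomial.X 1 + 1,
      MvPolynomial.X 2] P
    have hQ : ∀ G, MvPolynomial.aeval ![G, PowerSeries.X, Useries] Q =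
        MvPolynomial.aeval ![G, PowerSeries.X + 1, Useries] P := by
      intro G
      simp only [Q, MvPolynomial.aeval_def]
      rw [← MvPolynomial.coe_eval₂Hom, ← MvPolynomial.coe_eval₂Hom, ← MvPolynomial.coe_eval₂Hom,
        ← RingHom.comp_apply]
      congr 1
      apply MvPolynomial.ringHom_ext
      · intro r; simp
      · intro i
        fin_cases i <;> simp
    have hQP : MvPolynomial.aeval ![MvPolynomial.X 0, MvPolynomial.X 1 - 1,
      MvPolynomial.X 2] Q = P := by
      simp only [Q, MvPolynomial.aeval_def]
      rw [← MvPolynomial.coe_eval₂Hom, ← MvPolynomial.coe_eval₂Hom, ← RingHom.comp_apply]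
      conv_rhs => rw [← RingHom.id_apply P]
      congr 1
      apply MvPolynomial.ringHom_ext
      · intro r; simp [MvPolynomial.algebraMap_eq]
      · intro i
        fin_cases i <;> simp
    refine ⟨Q, ?_, ?_⟩
    · intro h
      rw [h, map_zero] at hQP
      exact hP0 hQP.symm
    · rw [hQ]
      apply compPS_inj (Eexp - 1) Eexp_sub_one_const Eexp_sub_one_one
      rw [compPS_eq_subst _ _ Eexp_sub_one_const]
      have hs := PowerSeries.HasSubst.of_constantCoeff_zero' (a := Eexp - 1) Eexp_sub_one_const
      rw [← PowerSeries.coe_substAlgHom (R := Polynomial ℚ) hs]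
      rw [← hroot]
      simp only [MvPolynomial.aeval_def]
      rw [← MvPolynomial.coe_eval₂Hom, ← MvPolynomial.coe_eval₂Hom, ← RingHom.coe_coe,
        ← RingHom.comp_apply]
      congr 1
      apply MvPolynomial.ringHom_ext
      · intro r
        simp
      · intro i
        fin_cases i
        · simp only [Fin.zero_eta, RingHom.comp_apply]
          rw [MvPolynomial.coe_eval₂Hom, MvPolynomial.coe_eval₂Hom, MvPolynomial.eval₂_X,
            MvPolynomial.eval₂_X]
          show PowerSeries.substAlgHom hs _ = FGF S
          rw [PowerSeries.coe_substAlgHom, ← compPS_eq_subst _ _ Eexp_sub_one_const]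
          exact (compPS_fhat _ _ Eexp_sub_one_const Eexp_sub_one_one).symm
        · simp only [RingHom.comp_apply]
          rw [MvPolynomial.coe_eval₂Hom, MvPolynomial.coe_eval₂Hom, MvPolynomial.eval₂_X,
            MvPolynomial.eval₂_X]
          show PowerSeries.substAlgHom hs (PowerSeries.X + 1) = Eexp
          rw [map_add, map_one, PowerSeries.coe_substAlgHom, PowerSeries.subst_X hs]
          ring
        · simp only [RingHom.comp_apply]
          rw [MvPolynomial.coe_eval₂Hom, MvPolynomial.coe_eval₂Hom, MvPolynomial.eval₂_X,
            MvPolynomial.eval₂_X]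
          show PowerSeries.substAlgHom hs Useries = Useries
          rw [PowerSeries.coe_substAlgHom]
          unfold Useries
          rw [PowerSeries.subst_C]
          rfl
  · intro h0
    have hw : w1 S = Eexu - 1 := if_neg h0
    rw [hw] at key
    let P : MvPolynomial (Fin 4) ℚ := MvPolynomial.aeval ![MvPolynomial.X 0, MvPolynomial.X 2 - 1,
      MvPolynomial.X 1 - 1, MvPolynomial.X 3] P4
    have hP : ∀ G, MvPolynomial.aeval ![G, Eexu, Eexp, Useries] P =
        MvPolynomial.aeval ![G, Eexp - 1, Eexu - 1, Useries] P4 := by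
      intro G
      simp only [P, MvPolynomial.aeval_def]
      rw [← MvPolynomial.coe_eval₂Hom, ← MvPolynomial.coe_eval₂Hom, ← MvPolynomial.coe_eval₂Hom,
        ← RingHom.comp_apply]
      congr 1
      apply MvPolynomial.ringHom_ext
      · intro r; simp
      · intro i
        fin_cases i <;> simp
    have huniq : ∀ G : PowerSeries (Polynomial ℚ),
          MvPolynomial.aeval ![G, Eexu, Eexp, Useries] P = 0 → G = FGF S := by
      intro G hG
      rw [hP] at hG
      exact key.2 G hG
    have hP0 : P ≠ 0 := by
      intro h
      have a := huniq 0 (by rw [h]; simp)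
      have b := huniq 1 (by rw [h]; simp)
      exact zero_ne_one (a.trans b.symm)
    exact ⟨P, hP0, by rw [hP]; exact key.1, huniq⟩

noncomputable def egf (g : ℕ → Polynomial ℚ) : PowerSeries (Polynomial ℚ) :=
  PowerSeries.mk fun j => Polynomial.C ((j.factorial : ℚ)⁻¹) * g j

lemma egf_deriv (g : ℕ → Polynomial ℚ) :
    PowerSeries.derivative (Polynomial ℚ) (egf g) = egf (fun j => g (j + 1)) := by
  ext1 n
  rw [PowerSeries.coeff_derivative]
  simp only [egf, PowerSeries.coeff_mk]
  have : ((n : Polynomial ℚ) + 1) = Polynomial.C ((n : ℚ) + 1) := by simp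
  rw [this, mul_right_comm, ← Polynomial.C_mul]
  congr 2
  rw [Nat.factorial_succ]
  push_cast
  have : ((n : ℚ) + 1) ≠ 0 := by positivity
  field_simp

lemma deriv_prod {R : Type} [CommRing R] {α : Type} [DecidableEq α] (E : Finset α) (p : α → PowerSeries R) :
    PowerSeries.derivative R (∏ e ∈ E, p e) =
      ∑ e ∈ E, ∏ a ∈ E, (if a = e then PowerSeries.derivative R (p a) else p a) := by
  induction E using Finset.induction_on with
  | empty => simp
  | insert a E ha ih =>
    rw [Finset.prod_insert ha, Derivation.leibniz, ih, Finset.sum_insert ha, Finset.prod_insert ha]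
    simp only [if_true, smul_eq_mul]
    rw [add_comm]
    congr 1
    · rw [mul_comm]
      congr 1
      refine Finset.prod_congr rfl fun x hx => ?_
      rw [if_neg]
      rintro rfl
      exact ha hx
    · rw [Finset.mul_sum]
      refine Finset.sum_congr rfl fun e he => ?_
      rw [Finset.prod_insert ha, if_neg]
      rintro rfl
      exact ha he

theorem egf_count {α : Type} [DecidableEq α] (E : Finset α) (n : ℕ) (g : α → ℕ → Polynomial ℚ) :
    ∑ f ∈ Fintype.piFinset (fun _ : Fin n => E),
      ∏ e ∈ E, g e (Finset.univ.filter fun i => f i = e).card =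
    Polynomial.C (n.factorial : ℚ) * PowerSeries.coeff n (∏ e ∈ E, egf (g e)) := by
  induction n generalizing g with
  | zero =>
    simp [egf, map_prod, PowerSeries.coeff_zero_eq_constantCoeff]
  | succ n ih =>
    have hd := PowerSeries.coeff_derivative (∏ e ∈ E, egf (g e)) n
    rw [deriv_prod] at hd
    have e1 : Polynomial.C ((n + 1).factorial : ℚ) * PowerSeries.coeff (n + 1) (∏ e ∈ E, egf (g e)) =
        Polynomial.C (n.factorial : ℚ) * (PowerSeries.coeff (n + 1) (∏ e ∈ E, egf (g e)) * (n + 1)) := by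
      rw [Nat.factorial_succ]
      simp
      ring
    rw [e1, ← hd, map_sum, Finset.mul_sum]
    have e2 : ∀ e ∈ E, Polynomial.C (n.factorial : ℚ) * PowerSeries.coeff n
        (∏ a ∈ E, (if a = e then PowerSeries.derivative (Polynomial ℚ) (egf (g a)) else egf (g a))) =
        ∑ f ∈ Fintype.piFinset (fun _ : Fin n => E),
          ∏ a ∈ E, g a (Finset.univ.filter fun i => (Fin.cons e f : Fin (n + 1) → α) i = a).card := by
      intro e he
      have := ih (fun a j => if a = e then g a (j + 1) else g a j)
      have e3 : ∀ a, egf (fun j => if a = e then g a (j + 1) else g a j) =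
          if a = e then PowerSeries.derivative (Polynomial ℚ) (egf (g a)) else egf (g a) := by
        intro a
        split_ifs
        · rw [egf_deriv]
        · rfl
      simp only [e3] at this
      rw [← this]
      refine Finset.sum_congr rfl fun f _ => Finset.prod_congr rfl fun a _ => ?_
      rw [Fin.univ_succ, Finset.filter_cons]
      simp only [Fin.cons_zero, Finset.filter_map]
      split_ifs with h1 h2 h2
      · simp [Function.comp_def]
      · exact absurd h1.symm h2
      · exact absurd h2.symm h1
      · simp [Function.comp_def]
    rw [Finset.sum_congr rfl e2, ← Finset.sum_product']
    refine Finset.sum_bij' (fun f _ => (f 0, fun i => f i.succ)) (fun p _ => Fin.cons p.1 p.2) ?_ ?_ ?_ ?_ ?_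
    · intro f hf
      simp only [Fintype.mem_piFinset, Finset.mem_product] at hf ⊢
      exact ⟨hf 0, fun i => hf _⟩
    · rintro ⟨e, f⟩ hf
      simp only [Fintype.mem_piFinset, Finset.mem_product] at hf ⊢
      intro i
      refine Fin.cases ?_ ?_ i
      · simpa using hf.1
      · intro j; simpa using hf.2 j
    · intro f _
      exact Fin.cons_self_tail f
    · rintro ⟨e, f⟩ _
      simp
    · intro f _
      have : (Fin.cons (f 0) (fun i => f (Fin.succ i)) : Fin (n + 1) → α) = f := Fin.cons_self_tail f
      rw [this]

/-- run number `τ` of a word -/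
def run (l : List (Finset ℕ)) (τ : ℕ) : Finset ℕ := l.getD τ ∅

def Realises {n : ℕ} (f : Fin n → ℕ × ℕ) (l : List (Finset ℕ)) : Prop :=
  ∀ τ h, (∃ i, f i = (τ, h)) ↔ h ∈ run l τ

def bigT (S : Set ℤ) (l : List (Finset ℕ)) (τ : ℕ) : Prop := (run l τ).card ≠ 1 ∨ (0 : ℤ) ∈ S

noncomputable def kap (S : Set ℤ) (l : List (Finset ℕ)) {n : ℕ} (f : Fin n → ℕ × ℕ) (i : Fin n) :
    ℕ ⊕ Fin n := if bigT S l (f i).1 then Sum.inl (f i).1 else Sum.inr i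

noncomputable def dimf (S : Set ℤ) (l : List (Finset ℕ)) {n : ℕ} (f : Fin n → ℕ × ℕ) : ℕ :=
  (Finset.univ.image (kap S l f)).card

noncomputable def wt (S : Set ℤ) (H : Finset ℕ) : PowerSeries (Polynomial ℚ) :=
  if H.card = 1 then w1 S else Useries * (Eexp - 1) ^ H.card

noncomputable def wordW (S : Set ℤ) (l : List (Finset ℕ)) : PowerSeries (Polynomial ℚ) :=
  (l.map (wt S)).prod

noncomputable def elts (l : List (Finset ℕ)) : Finset (ℕ × ℕ) :=
  (Finset.range l.length).biUnion fun τ => (run l τ).image fun h => (τ, h)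

lemma mem_elts (l : List (Finset ℕ)) (p : ℕ × ℕ) :
    p ∈ elts l ↔ p.1 ∈ Finset.range l.length ∧ p.2 ∈ run l p.1 := by
  rcases p with ⟨a, b⟩
  simp only [elts, Finset.mem_biUnion, Finset.mem_image, Prod.mk.injEq]
  constructor
  · rintro ⟨τ, h1, h, h2, rfl, rfl⟩; exact ⟨h1, h2⟩
  · rintro ⟨h1, h2⟩; exact ⟨a, h1, b, h2, rfl, rfl⟩

lemma run_lt {l : List (Finset ℕ)} {τ h : ℕ} (hh : h ∈ run l τ) : τ < l.length := by
  by_contra hc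
  unfold run at hh
  rw [List.getD_eq_default _ _ (by omega)] at hh
  simp at hh

lemma mem_elts' (l : List (Finset ℕ)) (p : ℕ × ℕ) : p ∈ elts l ↔ p.2 ∈ run l p.1 := by
  rw [mem_elts]
  exact ⟨fun h => h.2, fun h => ⟨Finset.mem_range.2 (run_lt h), h⟩⟩

lemma wordW_eq (S : Set ℤ) (l : List (Finset ℕ)) :
    wordW S l = ∏ τ ∈ Finset.range l.length, wt S (run l τ) := by
  induction l with
  | nil => simp [wordW]
  | cons H l ih =>
    rw [List.length_cons, Finset.prod_range_succ']
    simp only [wordW, List.map_cons, List.prod_cons] at ih ⊢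
    rw [ih, mul_comm]
    rfl

noncomputable def realisers (l : List (Finset ℕ)) (n : ℕ) : Finset (Fin n → ℕ × ℕ) :=
  (Fintype.piFinset fun _ : Fin n => elts l).filter fun f => Realises f l

lemma mem_realisers (l : List (Finset ℕ)) (n : ℕ) (f : Fin n → ℕ × ℕ) :
    f ∈ realisers l n ↔ Realises f l := by
  simp only [realisers, Finset.mem_filter, Fintype.mem_piFinset, and_iff_right_iff_imp]
  intro h i
  rw [mem_elts']
  exact (h _ _).1 ⟨i, rfl⟩

lemma dimf_eq (S : Set ℤ) (l : List (Finset ℕ)) {n : ℕ} (f : Fin n → ℕ × ℕ) (hf : Realises f l)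
    (hne : ∀ τ, τ < l.length → (run l τ).Nonempty) :
    dimf S l f = ∑ τ ∈ Finset.range l.length,
      if bigT S l τ then 1 else (Finset.univ.filter fun i => (f i).1 = τ).card := by
  unfold dimf
  have hφ : ∀ k ∈ Finset.univ.image (kap S l f),
      (Sum.elim id (fun i => (f i).1) : ℕ ⊕ Fin n → ℕ) k ∈ Finset.range l.length := by
    intro k hk
    obtain ⟨i, _, rfl⟩ := Finset.mem_image.1 hk
    have : (f i).1 < l.length := run_lt ((hf (f i).1 (f i).2).1 ⟨i, rfl⟩)
    unfold kap
    split_ifs <;> simpa using this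
  rw [Finset.card_eq_sum_card_fiberwise hφ]
  refine Finset.sum_congr rfl fun τ hτ => ?_
  split_ifs with hb
  · rw [Finset.card_eq_one]
    refine ⟨Sum.inl τ, ?_⟩
    ext k
    simp only [Finset.mem_filter, Finset.mem_image, Finset.mem_univ, true_and, Finset.mem_singleton]
    constructor
    · rintro ⟨⟨i, rfl⟩, h⟩
      unfold kap at h ⊢
      by_cases h1 : bigT S l (f i).1
      · rw [if_pos h1] at h ⊢
        simpa using h
      · rw [if_neg h1] at h
        simp only [Sum.elim_inr] at h
        rw [h] at h1
        exact absurd hb h1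
    · rintro rfl
      obtain ⟨h, hh⟩ := hne τ (Finset.mem_range.1 hτ)
      obtain ⟨i, hi⟩ := (hf τ h).2 hh
      refine ⟨⟨i, ?_⟩, by simp⟩
      unfold kap
      rw [hi, if_pos hb]
  · rw [← Finset.card_image_of_injective _ (Sum.inr_injective (α := ℕ) (β := Fin n))]
    congr 1
    ext k
    simp only [Finset.mem_filter, Finset.mem_image, Finset.mem_univ, true_and]
    constructor
    · rintro ⟨⟨i, rfl⟩, h⟩
      unfold kap at h ⊢
      by_cases h1 : bigT S l (f i).1
      · rw [if_pos h1] at h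
        simp only [Sum.elim_inl, id] at h
        rw [h] at h1
        exact absurd h1 hb
      · rw [if_neg h1] at h ⊢
        exact ⟨i, by simpa using h, rfl⟩
    · rintro ⟨i, hi, rfl⟩
      refine ⟨⟨i, ?_⟩, by simpa using hi⟩
      unfold kap
      rw [hi, if_neg hb]

lemma egf_t : egf (fun j => if j = 0 then 0 else 1) = Eexp - 1 := by
  ext1 n
  simp only [egf, Eexp, PowerSeries.coeff_mk, map_sub, PowerSeries.coeff_one]
  split_ifs with h
  · subst h; simp
  · simp

lemma egf_xu : egf (fun j => if j = 0 then 0 else Polynomial.X ^ j) = Eexu - 1 := by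
  ext1 n
  simp only [egf, Eexu, PowerSeries.coeff_mk, map_sub, PowerSeries.coeff_one]
  split_ifs with h
  · subst h; simp
  · simp [Polynomial.smul_eq_C_mul]

theorem sum_realisers (S : Set ℤ) (l : List (Finset ℕ)) (n : ℕ)
    (hne : ∀ τ, τ < l.length → (run l τ).Nonempty) :
    ∑ f ∈ realisers l n, (Polynomial.X : Polynomial ℚ) ^ dimf S l f =
      Polynomial.C (n.factorial : ℚ) * PowerSeries.coeff n (wordW S l) := by
  let g : ℕ × ℕ → ℕ → Polynomial ℚ := fun e j =>
    if j = 0 then 0 else if bigT S l e.1 then 1 else Polynomial.X ^ j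
  let cst : Polynomial ℚ := ∏ τ ∈ Finset.range l.length, if bigT S l τ then Polynomial.X else 1
  have h1 : wordW S l = PowerSeries.C cst * ∏ e ∈ elts l, egf (g e) := by
    rw [wordW_eq, Finset.prod_finset_product (elts l) (Finset.range l.length) (run l) (mem_elts l)]
    simp only [cst, map_prod]
    rw [← Finset.prod_mul_distrib]
    refine Finset.prod_congr rfl fun τ _ => ?_
    by_cases hb : bigT S l τ
    · have : ∀ h, egf (g (τ, h)) = Eexp - 1 := by
        intro h
        simp only [g, if_pos hb]
        exact egf_t
      simp only [this, Finset.prod_const, if_pos hb]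
      unfold wt
      split_ifs with hc
      · rcases hb with hb | hb
        · exact absurd hc hb
        · rw [w1, if_pos hb, hc, pow_one]; rfl
      · rfl
    · have : ∀ h, egf (g (τ, h)) = Eexu - 1 := by
        intro h
        simp only [g, if_neg hb]
        exact egf_xu
      simp only [this, Finset.prod_const, if_neg hb]
      simp only [bigT, not_or, not_not] at hb
      rw [wt, if_pos hb.1, w1, if_neg hb.2, hb.1]
      simp
  rw [h1, PowerSeries.coeff_C_mul, mul_left_comm, ← egf_count, Finset.mul_sum, realisers,
    Finset.sum_filter]
  refine Finset.sum_congr rfl fun f hf => ?_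
  rw [Fintype.mem_piFinset] at hf
  split_ifs with hR
  · rw [dimf_eq S l f hR hne, Finset.prod_finset_product (elts l) (Finset.range l.length) (run l) (mem_elts l)]
    simp only [cst]
    rw [← Finset.prod_mul_distrib, ← Finset.prod_pow_eq_pow_sum]
    refine Finset.prod_congr rfl fun τ _ => ?_
    have hcnt : ∀ h ∈ run l τ, (Finset.univ.filter fun i => f i = (τ, h)).card ≠ 0 := by
      intro h hh
      obtain ⟨i, hi⟩ := (hR τ h).2 hh
      exact Finset.card_ne_zero_of_mem (a := i) (by simp [hi])
    by_cases hb : bigT S l τ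
    · rw [if_pos hb, if_pos hb, Finset.prod_eq_one, pow_one, mul_one]
      intro h hh
      simp only [g]
      rw [if_neg (hcnt h hh), if_pos hb]
    · rw [if_neg hb, if_neg hb, one_mul]
      have hb' := hb
      simp only [bigT, not_or, not_not] at hb'
      obtain ⟨h, hh⟩ := Finset.card_eq_one.1 hb'.1
      have hm : h ∈ run l τ := by rw [hh]; simp
      have hc := hcnt h hm
      rw [hh, Finset.prod_singleton]
      simp only [g]
      rw [if_neg hc, if_neg hb]
      congr 2
      ext i
      simp only [Finset.mem_filter, Finset.mem_univ, true_and]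
      constructor
      · intro h2
        have : (f i).2 ∈ run l τ := by rw [← h2]; exact (hR _ _).1 ⟨i, rfl⟩
        rw [hh, Finset.mem_singleton] at this
        exact Prod.ext h2 this
      · intro h2; rw [h2]
  · have : ∃ e ∈ elts l, ∀ i, f i ≠ e := by
      by_contra hcon
      push Not at hcon
      apply hR
      intro τ h
      constructor
      · rintro ⟨i, hi⟩
        have := (mem_elts' l _).1 (hf i)
        rwa [hi] at this
      · intro hh
        exact hcon (τ, h) ((mem_elts' l _).2 hh)
    obtain ⟨e, he, hi⟩ := this
    symm
    apply mul_eq_zero_of_right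
    apply Finset.prod_eq_zero he
    have : (Finset.univ.filter fun i => f i = e).card = 0 := by simp [hi]
    simp [g, this]

structure Good (S : Set ℤ) : Prop where
  sym : ∀ s, s ∈ S → -s ∈ S
  cl : ∀ s t : ℤ, 0 ≤ s → 0 ≤ t → s + t ∈ S → s ∈ S ∨ t ∈ S

def CutConn (S : Set ℤ) (U : Set ℤ) : Prop :=
  ∀ c : ℤ, (∃ a ∈ U, a ≤ c) → (∃ b ∈ U, c < b) → ∃ a ∈ U, ∃ b ∈ U, a ≤ c ∧ c < b ∧ b - a ∈ S

def Rel (S : Set ℤ) (U V : Set ℤ) : Prop := ∃ u ∈ U, ∃ v ∈ V, u - v ∈ S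

lemma Good.sym' {S : Set ℤ} (hS : Good S) {a b : ℤ} (h : a - b ∈ S) : b - a ∈ S := by
  have := hS.sym _ h
  rwa [neg_sub] at this

lemma Good.mid {S : Set ℤ} (hS : Good S) {a p b : ℤ} (h1 : a ≤ p) (h2 : p ≤ b) (h : b - a ∈ S) :
    p - a ∈ S ∨ b - p ∈ S := by
  apply hS.cl _ _ (by omega) (by omega)
  rwa [show p - a + (b - p) = b - a by ring]

lemma Rel.symm {S : Set ℤ} (hS : Good S) {U V : Set ℤ} (h : Rel S U V) : Rel S V U := by
  obtain ⟨u, hu, v, hv, h⟩ := h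
  exact ⟨v, hv, u, hu, hS.sym' h⟩

lemma lemmaP {S : Set ℤ} (hS : Good S) {U : Set ℤ} (hU : CutConn S U) {a0 b0 p : ℤ}
    (ha : a0 ∈ U) (hb : b0 ∈ U) (h1 : a0 ≤ p) (h2 : p ≤ b0) (h3 : a0 < b0 ∨ (0 : ℤ) ∈ S) :
    ∃ u ∈ U, p - u ∈ S := by
  rcases lt_or_eq_of_le h2 with h4 | h4
  · obtain ⟨a, ha', b, hb', h5, h6, h7⟩ := hU p ⟨a0, ha, h1⟩ ⟨b0, hb, h4⟩
    rcases hS.mid h5 h6.le h7 with h | h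
    · exact ⟨a, ha', h⟩
    · exact ⟨b, hb', hS.sym' h⟩
  · rcases lt_or_eq_of_le h1 with h5 | h5
    · obtain ⟨a, ha', b, hb', h5, h6, h7⟩ := hU (p - 1) ⟨a0, ha, by omega⟩ ⟨b0, hb, by omega⟩
      rcases hS.mid (p := p) (by omega) (by omega) h7 with h | h
      · exact ⟨a, ha', h⟩
      · exact ⟨b, hb', hS.sym' h⟩
    · rcases h3 with h3 | h3
      · omega
      · exact ⟨a0, ha, by rw [h5, sub_self]; exact h3⟩

lemma lemmaO {S : Set ℤ} (hS : Good S) {U V : Set ℤ} (hU : CutConn S U) (hV : CutConn S V)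
    {a0 b0 a1 b1 : ℤ} (h1 : a0 ∈ U) (h2 : b0 ∈ U) (h3 : a1 ∈ V) (h4 : b1 ∈ V)
    (h5 : a0 ≤ b1) (h6 : a1 < b0) : Rel S U V := by
  rcases le_or_gt a0 a1 with h | h
  · obtain ⟨u, hu, h'⟩ := lemmaP hS hU h1 h2 h h6.le (Or.inl (by omega))
    exact ⟨u, hu, a1, h3, hS.sym' h'⟩
  · obtain ⟨u, hu, h'⟩ := lemmaP hS hV h3 h4 h.le h5 (Or.inl (by omega))
    exact ⟨a0, h1, u, hu, h'⟩

lemma two_colour {S : Set ℤ} (hS : Good S) {U : Set ℤ} (hU : CutConn S U) {α : Type*} (T : ℤ → α)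
    (hT : ∀ a ∈ U, ∀ b ∈ U, b - a ∈ S → T a = T b) : ∀ p ∈ U, ∀ q ∈ U, T p = T q := by
  have key : ∀ d : ℕ, ∀ p ∈ U, ∀ q ∈ U, p < q → q - p ≤ d → T p = T q := by
    intro d
    induction d with
    | zero => intro p _ q _ h1 h2; push_cast at h2; omega
    | succ d ih =>
      intro p hp q hq h1 h2
      push_cast at h2
      obtain ⟨a, ha, b, hb, h3, h4, h5⟩ := hU p ⟨p, hp, le_refl _⟩ ⟨q, hq, h1⟩
      have hab := hT a ha b hb h5
      have hpb : T p = T b := by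
        rcases hS.mid h3 h4.le h5 with h | h
        · rw [← hT a ha p hp h, hab]
        · exact hT p hp b hb h
      rcases lt_trichotomy b q with h6 | h6 | h6
      · rw [hpb]; exact ih b hb q hq h6 (by omega)
      · rw [hpb, h6]
      · rcases hS.mid (p := q) (by omega) h6.le h5 with h | h
        · rw [hpb, ← hab]; exact hT a ha q hq h
        · rw [hpb]; exact (hT q hq b hb h).symm
  intro p hp q hq
  rcases lt_trichotomy p q with h | h | h
  · exact key (q - p).toNat p hp q hq h (by omega)
  · rw [h]
  · exact (key (p - q).toNat q hq p hp h (by omega)).symm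

lemma CutConn.union {S : Set ℤ} (hS : Good S) {U V : Set ℤ} (hU : CutConn S U) (hV : CutConn S V)
    (h : Rel S U V) : CutConn S (U ∪ V) := by
  intro c hl hr
  by_cases h1 : (∃ a ∈ U, a ≤ c) ∧ (∃ b ∈ U, c < b)
  · obtain ⟨a, ha, b, hb, h⟩ := hU c h1.1 h1.2
    exact ⟨a, Or.inl ha, b, Or.inl hb, h⟩
  by_cases h2 : (∃ a ∈ V, a ≤ c) ∧ (∃ b ∈ V, c < b)
  · obtain ⟨a, ha, b, hb, h⟩ := hV c h2.1 h2.2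
    exact ⟨a, Or.inr ha, b, Or.inr hb, h⟩
  obtain ⟨u, hu, v, hv, h⟩ := h
  rcases le_or_gt u c with h3 | h3
  · rcases le_or_gt v c with h4 | h4
    · exfalso
      obtain ⟨b, hb | hb, hc⟩ := hr
      · exact h1 ⟨⟨u, hu, h3⟩, b, hb, hc⟩
      · exact h2 ⟨⟨v, hv, h4⟩, b, hb, hc⟩
    · exact ⟨u, Or.inl hu, v, Or.inr hv, h3, h4, hS.sym' h⟩
  · rcases le_or_gt v c with h4 | h4
    · exact ⟨v, Or.inr hv, u, Or.inl hu, h4, h3, h⟩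
    · exfalso
      obtain ⟨b, hb | hb, hc⟩ := hl
      · exact h1 ⟨⟨b, hb, hc⟩, u, hu, h3⟩
      · exact h2 ⟨⟨b, hb, hc⟩, v, hv, h4⟩

section Linked
variable {S : Set ℤ} (H : ℤ → Set ℤ)

def Lnk (S : Set ℤ) (H : ℤ → Set ℤ) (k l : ℤ) : Prop := k < l ∧ Rel S (H k) (H l)

lemma lnk_union (hS : Good S) (hc : ∀ k, CutConn S (H k)) {k l : ℤ}
    (h : Relation.TransGen (Lnk S H) k l) :
    ∃ U : Set ℤ, CutConn S U ∧ H k ⊆ U ∧ H l ⊆ U ∧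
      ∀ z ∈ U, ∃ j, (j = k ∨ Relation.TransGen (Lnk S H) k j) ∧ j ≤ l ∧ z ∈ H j := by
  induction h with
  | @single b h =>
    refine ⟨H k ∪ H b, (hc k).union hS (hc b) h.2, Set.subset_union_left, Set.subset_union_right, ?_⟩
    rintro z (hz | hz)
    · exact ⟨k, Or.inl rfl, h.1.le, hz⟩
    · exact ⟨b, Or.inr (.single h), le_refl _, hz⟩
  | @tail b c hkb hbc ih =>
    obtain ⟨U, hU, h1, h2, h3⟩ := ih
    refine ⟨U ∪ H c, hU.union hS (hc c) ?_, h1.trans Set.subset_union_left, Set.subset_union_right, ?_⟩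
    · obtain ⟨u, hu, v, hv, h⟩ := hbc.2
      exact ⟨u, h2 hu, v, hv, h⟩
    · rintro z (hz | hz)
      · obtain ⟨j, hj, hjb, hzj⟩ := h3 z hz
        exact ⟨j, hj, hjb.trans hbc.1.le, hzj⟩
      · exact ⟨c, Or.inr (.tail hkb hbc), le_refl _, hz⟩

lemma linked_of_le (hS : Good S) (hc : ∀ k, CutConn S (H k)) (hne : ∀ k, (H k).Nonempty)
    (hM : ∀ k, (∃ h ∈ H k, ∃ h' ∈ H (k + 1), h' < h) ∨ Rel S (H k) (H (k + 1))) (d : ℕ) :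
    ∀ k l : ℤ, l = k + d + 1 → ∀ a ∈ H k, ∀ b ∈ H l, a ≤ b →
      Relation.TransGen (Lnk S H) k l := by
  induction d with
  | zero =>
    intro k l hl a ha b hb hab
    push_cast at hl
    rw [add_zero] at hl
    subst hl
    refine .single ⟨by omega, ?_⟩
    rcases hM k with ⟨h, hh, h', hh', hlt⟩ | h
    · exact lemmaO hS (hc k) (hc _) ha hh hh' hb hab hlt
    · exact h
  | succ d ih =>
    intro k l hl a ha b hb hab
    obtain ⟨j, hj⟩ : ∃ j : ℤ, j = k + d + 1 := ⟨_, rfl⟩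
    have hlj : l = j + 1 := by push_cast at hl; omega
    subst hlj
    by_cases hcase : ∃ a' ∈ H k, ∃ e ∈ H j, a' ≤ e
    · obtain ⟨a', ha', e, he, hae⟩ := hcase
      have hkj := ih k j hj a' ha' e he hae
      rcases hM j with ⟨h, hh, h', hh', hlt⟩ | h
      · obtain ⟨U, hU, h1, h2, h3⟩ := lnk_union H hS hc hkj
        obtain ⟨u, hu, v, hv, huv⟩ := lemmaO hS hU (hc _) (h1 ha) (h2 hh) hh' hb hab hlt
        obtain ⟨i, hi, hij, hui⟩ := h3 u hu
        have hlast : Lnk S H i (j + 1) := ⟨by omega, u, hui, v, hv, huv⟩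
        rcases hi with rfl | hi
        · exact .single hlast
        · exact .tail hi hlast
      · exact .tail hkj ⟨by omega, h⟩
    · push Not at hcase
      obtain ⟨e, he⟩ := hne j
      have hea : e < a := hcase a ha e he
      have hrel : Rel S (H j) (H (j + 1)) := by
        rcases hM j with ⟨h, hh, h', hh', hlt⟩ | h
        · exact lemmaO hS (hc j) (hc _) he hh hh' hb (by omega) hlt
        · exact h
      obtain ⟨u, hu, hau⟩ := lemmaP hS ((hc j).union hS (hc (j + 1)) hrel) (Or.inl he) (Or.inr hb)
        hea.le hab (Or.inl (by omega))
      rcases hu with hu | hu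
      · exact .tail (.single ⟨by omega, a, ha, u, hu, hau⟩) ⟨by omega, hrel⟩
      · exact .single ⟨by omega, a, ha, u, hu, hau⟩
end Linked

/-- core of the injectivity argument -/
theorem compare_core {S : Set ℤ} (hS : Good S) {ι : Type*} (T : ℤ) (hT : 0 < T) (X : ι → ℤ) (y : ι → ℝ)
    (H : ℤ → Set ℤ) (hH : ∀ k g, g ∈ H k ↔ ∃ i, X i - T * g = k)
    (hc : ∀ k, CutConn S (H k)) (hne : ∀ k, (H k).Nonempty)
    (hM : ∀ k, (∃ h ∈ H k, ∃ h' ∈ H (k + 1), h' < h) ∨ Rel S (H k) (H (k + 1)))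
    (hxy : ∀ a b, ∀ s ∈ S, T * s ≤ X b - X a ↔ (s : ℝ) ≤ y b - y a) (a b : ι) (d : ℤ) (hd : 0 ≤ d) :
    (T * d < X b - X a → (d : ℝ) < y b - y a) ∧
    (1 ≤ d → T * d ≤ X b - X a → (d : ℝ) ≤ y b - y a) := by
  have heq : ∀ a b, ∀ s ∈ S, T * s = X b - X a → (s : ℝ) = y b - y a := by
    intro a b s hs h
    have h1 := (hxy a b s hs).1 h.le
    have h2 := (hxy b a (-s) (hS.sym s hs)).1 (by linarith)
    push_cast at h2
    linarith
  have hlt : ∀ a b, ∀ s ∈ S, T * s < X b - X a → (s : ℝ) < y b - y a := by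
    intro a b s hs h
    by_contra hcon
    have h2 := (hxy b a (-s) (hS.sym s hs)).2 (by push_cast; linarith)
    linarith
  -- equal times inside a group
  have hgrp : ∀ k i g i' g', X i - T * g = k → X i' - T * g' = k → (g ≠ g' ∨ (0 : ℤ) ∈ S) →
      y i - g = y i' - g' := by
    intro k i g i' g' h1 h2 h3
    have hg : g ∈ H k := (hH k g).2 ⟨i, h1⟩
    have hg' : g' ∈ H k := (hH k g').2 ⟨i', h2⟩
    have hch : ∀ q : ℤ, ∃ j : ι, q ∈ H k → X j - T * q = k := by
      intro q
      by_cases hq : q ∈ H k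
      · obtain ⟨j, hj⟩ := (hH k q).1 hq
        exact ⟨j, fun _ => hj⟩
      · exact ⟨a, fun h => absurd h hq⟩
    choose J hJ using hch
    have hcol := two_colour hS (hc k) (fun q => y (J q) - q) (by
      intro p hp q hq hpq
      have := heq (J p) (J q) (q - p) hpq (by linarith [hJ p hp, hJ q hq])
      push_cast at this
      show y (J p) - p = y (J q) - q
      linarith)
    have hnb : ∀ i r, X i - T * r = k → y i - r = y (J r) - r := by
      intro i r h1
      have hr : r ∈ H k := (hH k r).2 ⟨i, h1⟩
      have : ∃ q ∈ H k, r - q ∈ S := by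
        rcases h3 with h3 | h3
        · obtain ⟨e, he, hre⟩ : ∃ e ∈ H k, r ≠ e := by
            by_cases hrg : r = g
            · exact ⟨g', hg', by rw [hrg]; exact h3⟩
            · exact ⟨g, hg, hrg⟩
          rcases lt_or_gt_of_ne hre with h4 | h4
          · exact lemmaP hS (hc k) hr he le_rfl h4.le (Or.inl h4)
          · exact lemmaP hS (hc k) he hr h4.le le_rfl (Or.inl h4)
        · exact ⟨r, hr, by rwa [sub_self]⟩
      obtain ⟨q, hq, hgq⟩ := this
      have e1 := heq (J q) i (r - q) hgq (by linarith [hJ q hq])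
      have e2 : y (J r) - r = y (J q) - q := hcol r hr q hq
      push_cast at e1
      linarith
    rw [hnb i g h1, hnb i' g' h2]
    exact hcol g hg g' hg'
  have hlk1 : ∀ k l, Lnk S H k l → ∀ i g i' g', X i - T * g = k → X i' - T * g' = l →
      y i - g < y i' - g' := by
    rintro k l ⟨hkl, u, hu, v, hv, huv⟩ i g i' g' h1 h2
    have hpick : ∀ k i g u, X i - T * g = k → u ∈ H k → ∃ j, X j - T * u = k ∧ y j - u = y i - g := by
      intro k i g u h1 hu
      by_cases hgu : g = u
      · subst hgu; exact ⟨i, h1, rfl⟩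
      · obtain ⟨j, hj⟩ := (hH k u).1 hu
        exact ⟨j, hj, (hgrp k i g j u h1 hj (Or.inl hgu)).symm⟩
    obtain ⟨j, hj, hj'⟩ := hpick k i g u h1 hu
    obtain ⟨j', hj2, hj2'⟩ := hpick l i' g' v h2 hv
    have := hlt j j' (v - u) (hS.sym' huv) (by linarith)
    push_cast at this
    linarith
  have hlk : ∀ k l, Relation.TransGen (Lnk S H) k l → ∀ i g i' g', X i - T * g = k →
      X i' - T * g' = l → y i - g < y i' - g' := by
    intro k l h
    induction h with
    | single h => exact hlk1 _ _ h
    | @tail b c h1 h2 ih =>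
      intro i g i' g' e1 e2
      obtain ⟨q, hq⟩ := hne b
      obtain ⟨j, hj⟩ := (hH b q).1 hq
      exact (ih i g j q e1 hj).trans (hlk1 _ _ h2 j q i' g' hj e2)
  have main : T * d < X b - X a → (d : ℝ) < y b - y a := by
    intro h
    have hk : (0 : ℤ) ∈ H (X a) := (hH _ _).2 ⟨a, by ring⟩
    have hl : d ∈ H (X b - T * d) := (hH _ _).2 ⟨b, rfl⟩
    have := hlk _ _ (linked_of_le H hS hc hne hM (X b - T * d - X a - 1).toNat (X a) (X b - T * d)
      (by omega) 0 hk d hl hd) a 0 b d (by ring) rfl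
    push_cast at this
    linarith
  refine ⟨main, fun h1 h2 => ?_⟩
  rcases lt_or_eq_of_le h2 with h | h
  · exact (main h).le
  · have := hgrp (X a) a 0 b d (by ring) (by linarith) (Or.inl (by omega))
    push_cast at this
    linarith

lemma initial_eq {ι : Type*} (u v : ι → ℕ) (h : ∀ i j, u i < u j ↔ v i < v j)
    (hu : ∀ i, ∀ k < u i, ∃ j, u j = k) (hv : ∀ i, ∀ k < v i, ∃ j, v j = k) : u = v := by
  have key : ∀ (u v : ι → ℕ), (∀ i j, u i < u j ↔ v i < v j) →
      (∀ i, ∀ k < u i, ∃ j, u j = k) → ∀ m i, u i = m → u i ≤ v i := by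
    intro u v h hu m
    induction m with
    | zero => intro i hi; omega
    | succ m ih =>
      intro i hi
      obtain ⟨j, hj⟩ := hu i m (by omega)
      have h1 := (h j i).1 (by omega)
      have h2 := ih j hj
      omega
  funext i
  exact le_antisymm (key u v h hu _ i rfl) (key v u (fun i j => (h i j).symm) hv _ i rfl)

def up (H : Finset ℕ) : Set ℤ := {z | ∃ h ∈ H, (h : ℤ) = z}

def RelM (S : Set ℤ) (H H' : Finset ℕ) : Prop :=
  (∃ h ∈ H, ∃ h' ∈ H', h' < h) ∨ Rel S (up H) (up H')

def Runs (S : Set ℤ) (l : List (Finset ℕ)) : Prop :=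
  (∀ H ∈ l, H.Nonempty ∧ CutConn S (up H)) ∧ l.IsChain (RelM S)

def Normal (S : Set ℤ) (l : List (Finset ℕ)) : Prop :=
  Runs S l ∧ ∀ H ∈ l.head?, 0 ∈ H

noncomputable def pos (l : List (Finset ℕ)) {n : ℕ} (f : Fin n → ℕ × ℕ) (i : Fin n) : ℝ :=
  ((f i).2 : ℝ) + ((f i).1 : ℝ) / (l.length : ℝ)

def SEq (S : Set ℤ) {n : ℕ} (x y : Fin n → ℝ) : Prop :=
  ∀ a b, ∀ s ∈ S, (s : ℝ) ≤ x b - x a ↔ (s : ℝ) ≤ y b - y a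

lemma CutConn.shift {S U : Set ℤ} (h : CutConn S U) (q : ℤ) : CutConn S {z | z + q ∈ U} := by
  rintro c ⟨a, ha, hac⟩ ⟨b, hb, hcb⟩
  obtain ⟨a', ha', b', hb', h1, h2, h3⟩ := h (c + q) ⟨a + q, ha, by omega⟩ ⟨b + q, hb, by omega⟩
  refine ⟨a' - q, by simpa using ha', b' - q, by simpa using hb', by omega, by omega, ?_⟩
  rwa [show b' - q - (a' - q) = b' - a' by ring]

lemma run_eq_getElem {l : List (Finset ℕ)} {τ : ℕ} (h : τ < l.length) : run l τ = l[τ] := by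
  unfold run
  exact List.getD_eq_getElem _ _ h

lemma Runs.run_nonempty {S : Set ℤ} {l : List (Finset ℕ)} (h : Runs S l) (τ : ℕ) (hτ : τ < l.length) :
    (run l τ).Nonempty := by
  rw [run_eq_getElem hτ]
  exact (h.1 _ (List.getElem_mem hτ)).1

lemma Runs.run_cc {S : Set ℤ} {l : List (Finset ℕ)} (h : Runs S l) (τ : ℕ) (hτ : τ < l.length) :
    CutConn S (up (run l τ)) := by
  rw [run_eq_getElem hτ]
  exact (h.1 _ (List.getElem_mem hτ)).2

lemma Runs.run_rel {S : Set ℤ} {l : List (Finset ℕ)} (h : Runs S l) (τ : ℕ) (hτ : τ + 1 < l.length) :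
    RelM S (run l τ) (run l (τ + 1)) := by
  rw [run_eq_getElem hτ, run_eq_getElem (by omega)]
  exact List.isChain_iff_getElem.1 h.2 τ hτ

lemma Normal.zero_mem {S : Set ℤ} {l : List (Finset ℕ)} (h : Normal S l) (hl : 0 < l.length) :
    0 ∈ run l 0 := by
  cases l with
  | nil => simp at hl
  | cons H l => exact h.2 H (by simp)

theorem compare_normal {S : Set ℤ} (hS : Good S) {l : List (Finset ℕ)} (hl : Normal S l) {n : ℕ}
    (f : Fin n → ℕ × ℕ) (hf : Realises f l) (y : Fin n → ℝ) (hxy : SEq S (pos l f) y)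
    (a b : Fin n) (d : ℤ) (hd : 0 ≤ d) :
    ((d : ℝ) < pos l f b - pos l f a → (d : ℝ) < y b - y a) ∧
    (1 ≤ d → (d : ℝ) ≤ pos l f b - pos l f a → (d : ℝ) ≤ y b - y a) := by
  have hlt : ∀ i, (f i).1 < l.length := fun i => run_lt ((hf (f i).1 (f i).2).1 ⟨i, rfl⟩)
  have hlen : 0 < l.length := lt_of_le_of_lt (Nat.zero_le _) (hlt a)
  set T : ℤ := (l.length : ℤ) with hT
  have hTpos : 0 < T := by omega
  have hTR : (0 : ℝ) < (T : ℝ) := by exact_mod_cast hTpos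
  let X : Fin n → ℤ := fun i => T * (f i).2 + (f i).1
  have hX : ∀ i, pos l f i = (X i : ℝ) / T := by
    intro i
    have : (l.length : ℝ) = (T : ℝ) := by rw [hT]; simp
    simp only [pos, X, this]
    push_cast
    field_simp
  have hle : ∀ (a b : Fin n) (s : ℤ), (s : ℝ) ≤ pos l f b - pos l f a ↔ T * s ≤ X b - X a := by
    intro a b s
    rw [hX, hX, ← sub_div, le_div_iff₀ hTR]
    rw [← Int.cast_sub, ← Int.cast_mul, Int.cast_le, mul_comm]
  have hlt' : ∀ (a b : Fin n) (s : ℤ), (s : ℝ) < pos l f b - pos l f a ↔ T * s < X b - X a := by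
    intro a b s
    rw [hX, hX, ← sub_div, lt_div_iff₀ hTR]
    rw [← Int.cast_sub, ← Int.cast_mul, Int.cast_lt, mul_comm]
  let H : ℤ → Set ℤ := fun k => {g | ∃ i, X i - T * g = k}
  have hHrun : ∀ q : ℤ, ∀ τ : ℕ, τ < l.length → H (T * q + τ) = {z | z + q ∈ up (run l τ)} := by
    intro q τ hτ
    ext z
    simp only [H, X, Set.mem_setOf_eq, up]
    constructor
    · rintro ⟨i, hi⟩
      have h1 : ((f i).1 : ℤ) - τ = T * (q + z - (f i).2) := by linarith
      have h2 : q + z - (f i).2 = 0 := by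
        by_contra hne
        have h3 : |((f i).1 : ℤ) - τ| < T := by
          have := hlt i
          rw [abs_lt]; constructor <;> omega
        rw [h1, abs_mul, abs_of_pos hTpos] at h3
        have : 1 ≤ |q + z - (f i).2| := Int.one_le_abs hne
        nlinarith
      rw [h2, mul_zero] at h1
      have h3 : (f i).1 = τ := by omega
      refine ⟨(f i).2, ?_, by omega⟩
      rw [← h3]
      exact (hf _ _).1 ⟨i, rfl⟩
    · rintro ⟨h, hh, hz⟩
      obtain ⟨i, hi⟩ := (hf τ h).2 hh
      refine ⟨i, ?_⟩
      rw [hi]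
      simp only
      rw [hz]; ring
  have hdec : ∀ k : ℤ, ∃ q : ℤ, ∃ τ : ℕ, τ < l.length ∧ k = T * q + τ := by
    intro k
    refine ⟨k / T, (k % T).toNat, ?_, ?_⟩
    · have := Int.emod_lt_of_pos k hTpos
      have := Int.emod_nonneg k hTpos.ne'
      omega
    · have := Int.emod_nonneg k hTpos.ne'
      rw [Int.toNat_of_nonneg this]
      exact (Int.mul_ediv_add_emod k T).symm
  have hne : ∀ k, (H k).Nonempty := by
    intro k
    obtain ⟨q, τ, hτ, rfl⟩ := hdec k
    obtain ⟨h, hh⟩ := hl.1.run_nonempty τ hτ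
    rw [hHrun q τ hτ]
    exact ⟨h - q, h, hh, by ring⟩
  have hc : ∀ k, CutConn S (H k) := by
    intro k
    obtain ⟨q, τ, hτ, rfl⟩ := hdec k
    rw [hHrun q τ hτ]
    exact (hl.1.run_cc τ hτ).shift q
  have hM : ∀ k, (∃ h ∈ H k, ∃ h' ∈ H (k + 1), h' < h) ∨ Rel S (H k) (H (k + 1)) := by
    intro k
    obtain ⟨q, τ, hτ, rfl⟩ := hdec k
    by_cases hτ1 : τ + 1 < l.length
    · have e : T * q + (τ : ℤ) + 1 = T * q + ((τ + 1 : ℕ) : ℤ) := by push_cast; ring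
      rw [e, hHrun q τ hτ, hHrun q (τ + 1) hτ1]
      rcases hl.1.run_rel τ hτ1 with ⟨h, hh, h', hh', hlt⟩ | ⟨u, hu, v, hv, huv⟩
      · left
        exact ⟨h - q, ⟨h, hh, by ring⟩, h' - q, ⟨h', hh', by ring⟩, by omega⟩
      · right
        exact ⟨u - q, by simpa using hu, v - q, by simpa using hv, by
          rwa [show u - q - (v - q) = u - v by ring]⟩
    · left
      have e : T * q + (τ : ℤ) + 1 = T * (q + 1) + ((0 : ℕ) : ℤ) := by
        have : (τ : ℤ) + 1 = T := by omega
        push_cast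
        rw [add_assoc, this]; ring
      rw [e, hHrun q τ hτ, hHrun (q + 1) 0 hlen]
      obtain ⟨h, hh⟩ := hl.1.run_nonempty τ hτ
      refine ⟨h - q, ⟨h, hh, by ring⟩, 0 - (q + 1), ⟨0, hl.zero_mem hlen, by push_cast; ring⟩, by omega⟩
  have := compare_core hS T hTpos X y H (fun k g => Iff.rfl) hc hne hM
    (fun a b s hs => by rw [← hle]; exact hxy a b s hs) a b d hd
  rw [hlt', hle]
  exact this

lemma pos_floor {l : List (Finset ℕ)} {n : ℕ} {f : Fin n → ℕ × ℕ} (hf : Realises f l) (i : Fin n) :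
    ((f i).2 : ℝ) ≤ pos l f i ∧ pos l f i < (f i).2 + 1 := by
  have hlt : (f i).1 < l.length := run_lt ((hf (f i).1 (f i).2).1 ⟨i, rfl⟩)
  have h1 : (0 : ℝ) ≤ ((f i).1 : ℝ) / (l.length : ℝ) := by positivity
  have h2 : ((f i).1 : ℝ) / (l.length : ℝ) < 1 := by
    rw [div_lt_one (by exact_mod_cast (by omega))]
    exact_mod_cast hlt
  unfold pos
  constructor <;> linarith

theorem normal_inj {S : Set ℤ} (hS : Good S) {l l' : List (Finset ℕ)} (hl : Normal S l)
    (hl' : Normal S l') {n : ℕ} (f g : Fin n → ℕ × ℕ) (hf : Realises f l) (hg : Realises g l')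
    (h : SEq S (pos l f) (pos l' g)) : f = g := by
  rcases Nat.eq_zero_or_pos n with rfl | hn
  · funext i; exact i.elim0
  have h' : SEq S (pos l' g) (pos l f) := fun a b s hs => (h a b s hs).symm
  have c1 := compare_normal hS hl f hf _ h
  have c2 := compare_normal hS hl' g hg _ h'
  have hlt : ∀ a b (d : ℤ), 0 ≤ d →
      ((d : ℝ) < pos l f b - pos l f a ↔ (d : ℝ) < pos l' g b - pos l' g a) :=
    fun a b d hd => ⟨(c1 a b d hd).1, (c2 a b d hd).1⟩
  have hle : ∀ a b (d : ℤ), 1 ≤ d →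
      ((d : ℝ) ≤ pos l f b - pos l f a ↔ (d : ℝ) ≤ pos l' g b - pos l' g a) :=
    fun a b d hd => ⟨(c1 a b d (by omega)).2 hd, (c2 a b d (by omega)).2 hd⟩
  -- roots
  have hroot : ∀ (l : List (Finset ℕ)) (f : Fin n → ℕ × ℕ), Normal S l → Realises f l →
      ∃ r, pos l f r = 0 := by
    intro l f hl hf
    have hlen : 0 < l.length :=
      lt_of_le_of_lt (Nat.zero_le _) (run_lt ((hf _ _).1 ⟨(⟨0, hn⟩ : Fin n), rfl⟩))
    obtain ⟨r, hr⟩ := (hf 0 0).2 (hl.zero_mem hlen)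
    exact ⟨r, by simp [pos, hr]⟩
  have hnn : ∀ (l : List (Finset ℕ)) (f : Fin n → ℕ × ℕ) i, 0 ≤ pos l f i := by
    intro l f i; unfold pos; positivity
  obtain ⟨r, hr⟩ := hroot l f hl hf
  obtain ⟨r', hr'⟩ := hroot l' g hl' hg
  have hgr : pos l' g r = 0 := by
    by_contra hne
    have h1 : 0 < pos l' g r := lt_of_le_of_ne (hnn l' g r) (Ne.symm hne)
    have h2 := (hlt r' r 0 le_rfl).2 (by push_cast; linarith)
    push_cast at h2
    linarith [hnn l f r']
  have hheight : ∀ i, (f i).2 = (g i).2 := by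
    have aux : ∀ (l l' : List (Finset ℕ)) (f g : Fin n → ℕ × ℕ), Realises f l → Realises g l' →
        pos l f r = 0 → pos l' g r = 0 →
        (∀ a b (d : ℤ), 1 ≤ d →
          ((d : ℝ) ≤ pos l f b - pos l f a ↔ (d : ℝ) ≤ pos l' g b - pos l' g a)) →
        ∀ i, (f i).2 ≤ (g i).2 := by
      intro l l' f g hf hg h1 h2 h3 i
      by_contra hcon
      push Not at hcon
      have h4 := (h3 r i (f i).2 (by omega)).1 (by
        rw [h1, sub_zero]; push_cast; exact (pos_floor hf i).1)
      rw [h2, sub_zero] at h4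
      push_cast at h4
      have h5 := (pos_floor hg i).2
      have h6 : ((f i).2 : ℝ) < ((g i).2 : ℝ) + 1 := lt_of_le_of_lt h4 h5
      have h7 : (f i).2 < (g i).2 + 1 := by exact_mod_cast h6
      omega
    intro i
    exact le_antisymm (aux l l' f g hf hg hr hgr hle i)
      (aux l' l g f hg hf hgr hr (fun a b d hd => (hle a b d hd).symm) i)
  have htime : (fun i => (f i).1) = (fun i => (g i).1) := by
    have hdown : ∀ (l : List (Finset ℕ)) (f : Fin n → ℕ × ℕ), Normal S l → Realises f l →
        ∀ i, ∀ k < (f i).1, ∃ j, (f j).1 = k := by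
      intro l f hl hf i k hk
      have hlt : (f i).1 < l.length := run_lt ((hf (f i).1 (f i).2).1 ⟨i, rfl⟩)
      obtain ⟨h, hh⟩ := hl.1.run_nonempty k (by omega)
      obtain ⟨j, hj⟩ := (hf k h).2 hh
      exact ⟨j, by rw [hj]⟩
    have hord : ∀ (l : List (Finset ℕ)) (f : Fin n → ℕ × ℕ), Realises f l → ∀ i j,
        ((f i).1 < (f j).1 ↔ (((f j).2 : ℤ) - ((f i).2 : ℤ) : ℤ) < pos l f j - pos l f i) := by
      intro l f hf i j
      have hlt : (f i).1 < l.length := run_lt ((hf (f i).1 (f i).2).1 ⟨i, rfl⟩)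
      have hlR : (0 : ℝ) < (l.length : ℝ) := by exact_mod_cast (by omega)
      unfold pos
      push_cast
      rw [show ((f j).2 : ℝ) + ((f j).1 : ℝ) / (l.length : ℝ) - (((f i).2 : ℝ) + ((f i).1 : ℝ) / (l.length : ℝ))
        = ((f j).2 : ℝ) - ((f i).2 : ℝ) + (((f j).1 : ℝ) - ((f i).1 : ℝ)) / (l.length : ℝ) by ring]
      rw [lt_add_iff_pos_right, div_pos_iff_of_pos_right hlR, sub_pos, Nat.cast_lt]
    apply initial_eq
    · intro i j
      rw [hord l f hf, hord l' g hg, ← hheight i, ← hheight j]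
      rcases le_or_gt (0 : ℤ) (((f j).2 : ℤ) - ((f i).2 : ℤ)) with h1 | h1
      · exact hlt i j _ h1
      · have := hle j i (-(((f j).2 : ℤ) - ((f i).2 : ℤ))) (by omega)
        rw [← not_le, ← not_le, not_iff_not]
        rw [Int.cast_neg] at this
        constructor
        · intro h2
          have := this.1 (by linarith)
          linarith
        · intro h2
          have := this.2 (by linarith)
          linarith
    · exact hdown l f hl hf
    · exact hdown l' g hl' hg
  funext i
  exact Prod.ext (congrFun htime i) (hheight i)

lemma realises_unique {S : Set ℤ} {l l' : List (Finset ℕ)} (hl : Runs S l) (hl' : Runs S l') {n : ℕ}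
    {f : Fin n → ℕ × ℕ} (hf : Realises f l) (hf' : Realises f l') : l = l' := by
  have hrun : ∀ τ, run l τ = run l' τ := by
    intro τ; ext h; rw [← hf, ← hf']
  have aux : ∀ l l' : List (Finset ℕ), Runs S l → (∀ τ, run l τ = run l' τ) → l.length ≤ l'.length := by
    intro l l' hl h
    by_contra hc
    push Not at hc
    obtain ⟨x, hx⟩ := hl.run_nonempty l'.length hc
    rw [h] at hx
    exact absurd (run_lt hx) (lt_irrefl _)
  have hlen : l.length = l'.length :=
    le_antisymm (aux l l' hl hrun) (aux l' l hl' fun τ => (hrun τ).symm)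
  refine List.ext_getElem hlen fun τ h1 h2 => ?_
  rw [← run_eq_getElem h1, ← run_eq_getElem h2, hrun]

noncomputable def phi1 (δ : ℝ) : ℕ := ⌊δ⌋.toNat + if 0 < δ then 1 else 0

noncomputable def Phi {n : ℕ} (x : Fin n → ℝ) : ℕ := ∑ a, ∑ b, phi1 (x b - x a)

def IsMin (S : Set ℤ) {n : ℕ} (x : Fin n → ℝ) : Prop := ∀ z, SEq S z x → Phi x ≤ Phi z

def grp {n : ℕ} (x : Fin n → ℝ) (φ : ℝ) : Set ℤ := {g | ∃ i, Int.fract (x i) = φ ∧ ⌊x i⌋ = g}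

lemma exists_isMin (S : Set ℤ) {n : ℕ} (x : Fin n → ℝ) : ∃ z, SEq S z x ∧ IsMin S z := by
  have hne : ∃ k, ∃ z, SEq S z x ∧ Phi z = k := ⟨_, x, fun _ _ _ _ => Iff.rfl, rfl⟩
  obtain ⟨z, hz, hk⟩ := Nat.find_spec hne
  refine ⟨z, hz, fun w hw => ?_⟩
  rw [hk]
  exact Nat.find_min' hne ⟨w, fun a b s hs => (hw a b s hs).trans (hz a b s hs), rfl⟩

lemma minimal_pairs {S : Set ℤ} {n : ℕ} {x z : Fin n → ℝ} (hx : IsMin S x)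
    (h : ∀ a b, (∀ s ∈ S, ((s : ℝ) ≤ z b - z a ↔ (s : ℝ) ≤ x b - x a)) ∧
      phi1 (z b - z a) ≤ phi1 (x b - x a)) :
    (∀ a b, ¬ phi1 (z b - z a) < phi1 (x b - x a)) ∧ IsMin S z := by
  have hs : SEq S z x := fun a b s hs => (h a b).1 s hs
  have hle : Phi z ≤ Phi x := Finset.sum_le_sum fun a _ => Finset.sum_le_sum fun b _ => (h a b).2
  constructor
  · intro a b hlt
    have : Phi z < Phi x := by
      refine Finset.sum_lt_sum (fun a _ => Finset.sum_le_sum fun b _ => (h a b).2) ⟨a, Finset.mem_univ _, ?_⟩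
      exact Finset.sum_lt_sum (fun b _ => (h a b).2) ⟨b, Finset.mem_univ _, hlt⟩
    exact absurd (hx z hs) (by omega)
  · intro w hw
    exact hle.trans (hx w fun a b s hS => (hw a b s hS).trans (hs a b s hS))

lemma phi1_le_of_floor {δ δ' : ℝ} (h : ⌊δ'⌋ = ⌊δ⌋) (hp : 0 < δ' → 0 < δ) : phi1 δ' ≤ phi1 δ := by
  unfold phi1
  rw [h]
  split_ifs with h1 h2 h2
  · exact le_rfl
  · exact absurd (hp h1) h2
  · omega
  · exact le_rfl

lemma cmp_of_floor {δ δ' : ℝ} (h : ⌊δ'⌋ = ⌊δ⌋) (s : ℤ) : ((s : ℝ) ≤ δ' ↔ (s : ℝ) ≤ δ) := by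
  rw [← Int.le_floor, ← Int.le_floor, h]

lemma pair_of_floor {S : Set ℤ} {δ δ' : ℝ} (h : ⌊δ'⌋ = ⌊δ⌋) (hp : 0 < δ' → 0 < δ) :
    (∀ s ∈ S, ((s : ℝ) ≤ δ' ↔ (s : ℝ) ≤ δ)) ∧ phi1 δ' ≤ phi1 δ :=
  ⟨fun s _ => cmp_of_floor h s, phi1_le_of_floor h hp⟩

theorem IsMin.cutConn {S : Set ℤ} {n : ℕ} {x : Fin n → ℝ} (hx : IsMin S x) (φ : ℝ) :
    CutConn S (grp x φ) := by
  rintro c ⟨ga, ⟨a0, ha0, rfl⟩, hac⟩ ⟨gb, ⟨b0, hb0, rfl⟩, hcb⟩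
  by_contra hcon
  push Not at hcon
  obtain ⟨ε, ⟨hε, hε1⟩, hε0⟩ : ∃ ε : ℝ, ((∀ a b, 0 < Int.fract (x b - x a) → ε < Int.fract (x b - x a)) ∧ ε < 1) ∧
      0 < ε := by
    have h1 : ∀ᶠ ε in nhdsWithin (0 : ℝ) (Set.Ioi 0),
        ∀ a b, 0 < Int.fract (x b - x a) → ε < Int.fract (x b - x a) := by
      rw [Filter.eventually_all]
      intro a
      rw [Filter.eventually_all]
      intro b
      by_cases h : 0 < Int.fract (x b - x a)
      · filter_upwards [nhdsWithin_le_nhds (Iio_mem_nhds h)] with ε h1 _ using h1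
      · exact Filter.Eventually.of_forall fun ε h' => absurd h' h
    have h2 : ∀ᶠ ε in nhdsWithin (0 : ℝ) (Set.Ioi 0), ε < 1 :=
      nhdsWithin_le_nhds (Iio_mem_nhds one_pos)
    exact ((h1.and h2).and self_mem_nhdsWithin).exists
  let D : Fin n → Prop := fun i => Int.fract (x i) = φ ∧ c < ⌊x i⌋
  let z : Fin n → ℝ := fun i => if D i then x i - ε else x i
  have hInt : ∀ a b, Int.fract (x b - x a) = 0 → Int.fract (x a) = Int.fract (x b) ∧
      x b - x a = ((⌊x b⌋ - ⌊x a⌋ : ℤ) : ℝ) := by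
    intro a b h
    have h1 : Int.fract (x a) = Int.fract (x b) := by
      rw [eq_comm, Int.fract_eq_fract]
      refine ⟨⌊x b - x a⌋, ?_⟩
      have := Int.floor_add_fract (x b - x a)
      rw [h, add_zero] at this
      exact this.symm
    refine ⟨h1, ?_⟩
    have h2 := Int.floor_add_fract (x b)
    have h3 := Int.floor_add_fract (x a)
    push_cast
    linarith
  have hdown : ∀ a b, ¬ D a → D b → Int.fract (x b - x a) = 0 →
      ∃ d : ℤ, 1 ≤ d ∧ d ∉ S ∧ x b - x a = d := by
    intro a b hna hb h
    obtain ⟨h1, h2⟩ := hInt a b h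
    have hac' : ⌊x a⌋ ≤ c := by
      by_contra hc
      exact hna ⟨h1.trans hb.1, by omega⟩
    refine ⟨⌊x b⌋ - ⌊x a⌋, by have := hb.2; omega, ?_, h2⟩
    exact hcon _ ⟨a, h1.trans hb.1, rfl⟩ _ ⟨b, hb.1, rfl⟩ hac' hb.2
  have hpair : ∀ a b, (∀ s ∈ S, ((s : ℝ) ≤ z b - z a ↔ (s : ℝ) ≤ x b - x a)) ∧
      phi1 (z b - z a) ≤ phi1 (x b - x a) := by
    intro a b
    by_cases ha : D a <;> by_cases hb : D b
    · simp only [z, if_pos ha, if_pos hb]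
      rw [show x b - ε - (x a - ε) = x b - x a by ring]
      exact ⟨fun _ _ => Iff.rfl, le_rfl⟩
    · simp only [z, if_pos ha, if_neg hb]
      rw [show x b - (x a - ε) = x b - x a + ε by ring]
      have hfl : ⌊x b - x a + ε⌋ = ⌊x b - x a⌋ := by
        rw [Int.floor_eq_iff]
        have h1 := Int.floor_le (x b - x a)
        refine ⟨by linarith, ?_⟩
        have h2 := Int.floor_add_fract (x b - x a)
        rcases (Int.fract_nonneg (x b - x a)).eq_or_lt with h3 | h3
        · rw [← h3] at h2; linarith
        · have h4 : Int.fract (x a - x b) = 1 - Int.fract (x b - x a) := by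
            rw [← neg_sub (x b) (x a)]
            exact Int.fract_neg h3.ne'
          have h5 := hε b a (by rw [h4]; linarith [Int.fract_lt_one (x b - x a)])
          rw [h4] at h5
          linarith
      refine pair_of_floor hfl fun h => ?_
      by_contra hneg
      push Not at hneg
      rcases hneg.eq_or_lt with h1 | h1
      · have : x a = x b := by linarith
        apply hb
        show Int.fract (x b) = φ ∧ c < ⌊x b⌋
        rw [← this]; exact ha
      · have h2 : ⌊x b - x a⌋ < 0 := Int.floor_lt.2 (by simpa using h1)
        rw [← hfl, Int.floor_lt] at h2
        push_cast at h2
        linarith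
    · simp only [z, if_neg ha, if_pos hb]
      rw [show x b - ε - x a = x b - x a - ε by ring]
      rcases (Int.fract_nonneg (x b - x a)).eq_or_lt with h3 | h3
      · obtain ⟨d, hd1, hdS, hd⟩ := hdown a b ha hb h3.symm
        rw [hd]
        have hfl : ⌊(d : ℝ) - ε⌋ = d - 1 := by
          rw [Int.floor_eq_iff]; push_cast; constructor <;> linarith
        constructor
        · intro s hs
          rw [← Int.le_floor, hfl, Int.cast_le]
          have : s ≠ d := fun h => hdS (h ▸ hs)
          omega
        · unfold phi1
          rw [hfl, Int.floor_intCast]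
          have h1 : (0 : ℝ) < d := by exact_mod_cast (by omega)
          rw [if_pos h1]
          split_ifs <;> omega
      · refine pair_of_floor ?_ (by intro h; linarith)
        rw [Int.floor_eq_iff]
        have h2 := Int.floor_add_fract (x b - x a)
        have h4 := hε a b h3
        have h5 := Int.fract_lt_one (x b - x a)
        constructor <;> linarith
    · have hza : z a = x a := if_neg ha
      have hzb : z b = x b := if_neg hb
      rw [hza, hzb]
      exact ⟨fun _ _ => Iff.rfl, le_rfl⟩
  have hna : ¬ D a0 := fun h => by have := h.2; omega
  have hb : D b0 := ⟨hb0, hcb⟩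
  apply (minimal_pairs hx hpair).1 a0 b0
  simp only [z, if_neg hna, if_pos hb]
  have h0 : Int.fract (x b0 - x a0) = 0 := by
    have h2 := Int.floor_add_fract (x b0)
    have h3 := Int.floor_add_fract (x a0)
    have : x b0 - x a0 = ((⌊x b0⌋ - ⌊x a0⌋ : ℤ) : ℝ) := by push_cast; linarith
    rw [this, Int.fract_intCast]
  obtain ⟨d, hd1, hdS, hd⟩ := hdown a0 b0 hna hb h0
  rw [show x b0 - ε - x a0 = x b0 - x a0 - ε by ring, hd]
  have hfl : ⌊(d : ℝ) - ε⌋ = d - 1 := by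
    rw [Int.floor_eq_iff]; push_cast; constructor <;> linarith
  unfold phi1
  rw [hfl, Int.floor_intCast]
  have h1 : (0 : ℝ) < d := by exact_mod_cast (by omega)
  rw [if_pos h1]
  split_ifs <;> omega

theorem IsMin.rel {S : Set ℤ} (hS : Good S) {n : ℕ} {x : Fin n → ℝ} (hx : IsMin S x) (φ φ' : ℝ)
    (hlt : φ < φ') (hn : (grp x φ).Nonempty) (hn' : (grp x φ').Nonempty)
    (hcons : ∀ i, Int.fract (x i) ≤ φ ∨ φ' ≤ Int.fract (x i)) :
    (∃ h ∈ grp x φ, ∃ h' ∈ grp x φ', h' < h) ∨ Rel S (grp x φ) (grp x φ') := by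
  by_contra hcon
  push Not at hcon
  obtain ⟨hord, hrel⟩ := hcon
  have hφ0 : 0 ≤ φ := by obtain ⟨g, i, hi, _⟩ := hn; rw [← hi]; exact Int.fract_nonneg _
  have hφ1 : φ' < 1 := by obtain ⟨g, i, hi, _⟩ := hn'; rw [← hi]; exact Int.fract_lt_one _
  let D : Fin n → Prop := fun i => Int.fract (x i) = φ'
  let z : Fin n → ℝ := fun i => if D i then x i - (φ' - φ) else x i
  have hdiff : ∀ a b, x b - x a = ((⌊x b⌋ - ⌊x a⌋ : ℤ) : ℝ) + (Int.fract (x b) - Int.fract (x a)) := by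
    intro a b
    have h2 := Int.floor_add_fract (x b)
    have h3 := Int.floor_add_fract (x a)
    push_cast; linarith
  have hpair : ∀ a b, (∀ s ∈ S, ((s : ℝ) ≤ z b - z a ↔ (s : ℝ) ≤ x b - x a)) ∧
      phi1 (z b - z a) ≤ phi1 (x b - x a) := by
    intro a b
    have ha0 := Int.fract_nonneg (x a)
    have ha1 := Int.fract_lt_one (x a)
    have hb0 := Int.fract_nonneg (x b)
    have hb1 := Int.fract_lt_one (x b)
    by_cases ha : D a <;> by_cases hb : D b
    · simp only [z, if_pos ha, if_pos hb]
      rw [show x b - (φ' - φ) - (x a - (φ' - φ)) = x b - x a by ring]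
      exact ⟨fun _ _ => Iff.rfl, le_rfl⟩
    · simp only [z, if_pos ha, if_neg hb]
      have hd := hdiff a b
      have ha' : Int.fract (x a) = φ' := ha
      rw [show x b - (x a - (φ' - φ)) = x b - x a + (φ' - φ) by ring, hd, ha']
      set k : ℤ := ⌊x b⌋ - ⌊x a⌋ with hk
      rcases hcons b with h1 | h1
      · rcases h1.eq_or_lt with h2 | h2
        · -- tie
          have hk0 : k ≤ 0 := by
            have := hord ⌊x b⌋ ⟨b, h2, rfl⟩ ⌊x a⌋ ⟨a, ha', rfl⟩
            omega
          have hkS : k ∉ S := fun h => hrel ⟨⌊x b⌋, ⟨b, h2, rfl⟩, ⌊x a⌋, ⟨a, ha', rfl⟩, h⟩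
          rw [h2, show (k : ℝ) + (φ - φ') + (φ' - φ) = k by ring]
          have hfl : ⌊(k : ℝ) + (φ - φ')⌋ = k - 1 := by
            rw [Int.floor_eq_iff]; push_cast; constructor <;> linarith
          have hkR : (k : ℝ) ≤ 0 := by exact_mod_cast hk0
          constructor
          · intro s hs
            rw [← Int.le_floor (a := (k : ℝ) + (φ - φ')), hfl, Int.cast_le]
            have : s ≠ k := fun h => hkS (h ▸ hs)
            omega
          · unfold phi1
            rw [if_neg (by linarith), hfl, Int.floor_intCast]
            omega
        · refine pair_of_floor ?_ ?_
          · rw [(Int.floor_eq_iff (z := k - 1)).2, (Int.floor_eq_iff (z := k - 1)).2]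
            all_goals push_cast; constructor <;> linarith
          · intro h3
            have : (0 : ℝ) < k := by linarith
            have : (1 : ℝ) ≤ k := by exact_mod_cast (by exact_mod_cast this : 0 < k)
            linarith
      · have h2 : φ' < Int.fract (x b) := lt_of_le_of_ne h1 (fun h => hb h.symm)
        refine pair_of_floor ?_ ?_
        · rw [(Int.floor_eq_iff (z := k)).2, (Int.floor_eq_iff (z := k)).2]
          all_goals constructor <;> linarith
        · intro h3
          have : (-1 : ℝ) < k := by linarith
          have h4 : (-1 : ℤ) < k := by exact_mod_cast this
          have : (0 : ℝ) ≤ k := by exact_mod_cast (by omega)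
          linarith
    · simp only [z, if_neg ha, if_pos hb]
      have hd := hdiff a b
      have hb' : Int.fract (x b) = φ' := hb
      rw [show x b - (φ' - φ) - x a = x b - x a - (φ' - φ) by ring, hd, hb']
      set k : ℤ := ⌊x b⌋ - ⌊x a⌋ with hk
      rcases hcons a with h1 | h1
      · refine pair_of_floor ?_ (by intro h; linarith)
        rw [(Int.floor_eq_iff (z := k)).2, (Int.floor_eq_iff (z := k)).2]
        all_goals constructor <;> linarith
      · have h2 : φ' < Int.fract (x a) := lt_of_le_of_ne h1 (fun h => ha h.symm)
        refine pair_of_floor ?_ (by intro h; linarith)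
        rw [(Int.floor_eq_iff (z := k - 1)).2, (Int.floor_eq_iff (z := k - 1)).2]
        all_goals push_cast; constructor <;> linarith
    · have hza : z a = x a := if_neg ha
      have hzb : z b = x b := if_neg hb
      rw [hza, hzb]
      exact ⟨fun _ _ => Iff.rfl, le_rfl⟩
  obtain ⟨hno, hzmin⟩ := minimal_pairs hx hpair
  -- heights of groups differ
  have hne : ∀ a b, Int.fract (x a) = φ → Int.fract (x b) = φ' → ⌊x a⌋ < ⌊x b⌋ := by
    intro a b ha hb
    have h1 := hord ⌊x a⌋ ⟨a, ha, rfl⟩ ⌊x b⌋ ⟨b, hb, rfl⟩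
    rcases h1.lt_or_eq with h2 | h2
    · exact h2
    · exfalso
      apply hno a b
      have hDa : ¬ D a := fun h => by have h' : Int.fract (x a) = φ' := h; linarith
      have hDb : D b := hb
      simp only [z, if_neg hDa, if_pos hDb]
      have hd := hdiff a b
      rw [show x b - (φ' - φ) - x a = x b - x a - (φ' - φ) by ring, hd, hb, ha, ← h2]
      simp only [sub_self, Int.cast_zero, zero_add]
      unfold phi1
      rw [if_neg (lt_irrefl _), if_pos (by linarith)]
      simp
  have hgrp : ∀ g, g ∈ grp z φ ↔ g ∈ grp x φ ∨ g ∈ grp x φ' := by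
    intro g
    have hzi : ∀ i, D i → z i = ⌊x i⌋ + φ := by
      intro i hi
      have h2 := Int.floor_add_fract (x i)
      have hi' : Int.fract (x i) = φ' := hi
      simp only [z, if_pos hi]
      linarith
    constructor
    · rintro ⟨i, h1, h2⟩
      by_cases hi : D i
      · right
        refine ⟨i, hi, ?_⟩
        rw [hzi i hi, Int.floor_intCast_add, Int.floor_eq_zero_iff.2 ⟨hφ0, by linarith⟩, add_zero] at h2
        exact h2
      · left
        simp only [z, if_neg hi] at h1 h2
        exact ⟨i, h1, h2⟩
    · rintro (⟨i, h1, h2⟩ | ⟨i, h1, h2⟩)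
      · have hi : ¬ D i := fun h => by have h' : Int.fract (x i) = φ' := h; linarith
        refine ⟨i, ?_, ?_⟩ <;> simp only [z, if_neg hi] <;> assumption
      · have hi : D i := h1
        refine ⟨i, ?_, ?_⟩
        · rw [hzi i hi, Int.fract_intCast_add]
          exact Int.fract_eq_self.2 ⟨hφ0, by linarith⟩
        · rw [hzi i hi, Int.floor_intCast_add, Int.floor_eq_zero_iff.2 ⟨hφ0, by linarith⟩, add_zero]
          exact h2
  -- maximal height of the lower group
  obtain ⟨gm, ⟨im, him, himg⟩, hmax⟩ : ∃ g ∈ grp x φ, ∀ g' ∈ grp x φ, g' ≤ g := by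
    have hfin : (grp x φ).Finite := by
      apply (Set.finite_range fun i => ⌊x i⌋).subset
      rintro g ⟨i, _, hi⟩
      exact ⟨i, hi⟩
    obtain ⟨g, hg, hmax⟩ := Set.exists_max_image _ id hfin hn
    exact ⟨g, hg, hmax⟩
  obtain ⟨g', hg'⟩ := hn'
  obtain ⟨ib, hib, hibg⟩ := id hg'
  obtain ⟨a, ha, b, hb, h1, h2, h3⟩ := hzmin.cutConn φ gm
    ⟨gm, (hgrp _).2 (Or.inl ⟨im, him, himg⟩), le_rfl⟩
    ⟨g', (hgrp _).2 (Or.inr hg'), by rw [← himg, ← hibg]; exact hne im ib him hib⟩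
  rw [hgrp] at ha hb
  rcases hb with hb | hb
  · have := hmax b hb; omega
  · rcases ha with ha | ⟨ia, hia, hiag⟩
    · exact hrel ⟨a, ha, b, hb, hS.sym' h3⟩
    · have := hne im ia him hia
      omega

lemma cmp_frac (s k : ℤ) {p q p' q' : ℝ} (hp : 0 ≤ p) (hp1 : p < 1) (hq : 0 ≤ q) (hq1 : q < 1)
    (hp' : 0 ≤ p') (hp1' : p' < 1) (hq' : 0 ≤ q') (hq1' : q' < 1) (h : p ≤ q ↔ p' ≤ q') :
    (s : ℝ) ≤ k + (q - p) ↔ (s : ℝ) ≤ k + (q' - p') := by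
  rcases lt_trichotomy s k with h1 | h1 | h1
  · have : (s : ℝ) + 1 ≤ k := by exact_mod_cast h1
    constructor <;> intro _ <;> linarith
  · subst h1
    constructor <;> intro h2
    · have := h.1 (by linarith); linarith
    · have := h.2 (by linarith); linarith
  · have : (k : ℝ) + 1 ≤ s := by exact_mod_cast h1
    constructor <;> intro _ <;> linarith

lemma IsMin.translate {S : Set ℤ} {n : ℕ} {x : Fin n → ℝ} (hx : IsMin S x) (c : ℝ) :
    IsMin S (fun i => x i - c) := by
  intro w hw
  have h1 : Phi (fun i => x i - c) = Phi x := by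
    unfold Phi
    simp only [sub_sub_sub_cancel_right]
  rw [h1]
  apply hx
  intro a b s hs
  rw [hw a b s hs]
  simp only [sub_sub_sub_cancel_right]

theorem normal_surj {S : Set ℤ} (hS : Good S) {n : ℕ} (x : Fin n → ℝ) :
    ∃ l, Normal S l ∧ ∃ f : Fin n → ℕ × ℕ, Realises f l ∧ SEq S (pos l f) x := by
  rcases Nat.eq_zero_or_pos n with rfl | hn
  · refine ⟨[], ⟨⟨by simp, by simp⟩, by simp⟩, Fin.elim0, ?_, fun a => a.elim0⟩
    intro τ h
    simp [run]
  obtain ⟨z0, hz0, hmin0⟩ := exists_isMin S x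
  have : Nonempty (Fin n) := ⟨⟨0, hn⟩⟩
  obtain ⟨i0, hi0⟩ := Finite.exists_min z0
  set z : Fin n → ℝ := fun i => z0 i - z0 i0 with hz
  have hmin : IsMin S z := hmin0.translate _
  have hzx : SEq S z x := by
    intro a b s hs
    rw [← hz0 a b s hs]
    simp only [hz, sub_sub_sub_cancel_right]
  have hz_nonneg : ∀ i, 0 ≤ z i := fun i => sub_nonneg.2 (hi0 i)
  have hzi0 : z i0 = 0 := sub_self _
  clear_value z
  clear hz
  have hfl : ∀ i, 0 ≤ ⌊z i⌋ := fun i => Int.floor_nonneg.2 (hz_nonneg i)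
  let V : Finset ℝ := Finset.univ.image fun i => Int.fract (z i)
  let e : Fin V.card ≃o V := V.orderIsoOfFin rfl
  let Hf : ℝ → Finset ℕ := fun φ =>
    (Finset.univ.filter fun i => Int.fract (z i) = φ).image fun i => ⌊z i⌋.toNat
  have hup : ∀ φ, up (Hf φ) = grp z φ := by
    intro φ
    ext g
    simp only [up, Hf, grp, Set.mem_setOf_eq, Finset.mem_image, Finset.mem_filter, Finset.mem_univ,
      true_and]
    constructor
    · rintro ⟨h, ⟨i, hi, rfl⟩, rfl⟩
      exact ⟨i, hi, by have := hfl i; omega⟩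
    · rintro ⟨i, hi, rfl⟩
      exact ⟨_, ⟨i, hi, rfl⟩, by have := hfl i; omega⟩
  have hmemV : ∀ i, Int.fract (z i) ∈ V := fun i => Finset.mem_image_of_mem _ (Finset.mem_univ _)
  have hVex : ∀ φ ∈ V, ∃ i, Int.fract (z i) = φ := by
    intro φ h
    obtain ⟨i, _, hi⟩ := Finset.mem_image.1 h
    exact ⟨i, hi⟩
  let l : List (Finset ℕ) := List.ofFn fun k => Hf (e k)
  have hlen : l.length = V.card := List.length_ofFn
  let f : Fin n → ℕ × ℕ := fun i => ((e.symm ⟨_, hmemV i⟩ : Fin V.card).1, ⌊z i⌋.toNat)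
  have hrun : ∀ τ (h : τ < V.card), run l τ = Hf (e ⟨τ, h⟩) := by
    intro τ h
    rw [run_eq_getElem (by rw [hlen]; exact h)]
    simp [l]
  have hreal : Realises f l := by
    intro τ h
    constructor
    · rintro ⟨i, hi⟩
      simp only [f, Prod.mk.injEq] at hi
      obtain ⟨h1, h2⟩ := hi
      subst h1
      rw [hrun _ (e.symm ⟨_, hmemV i⟩).2]
      simp only [Fin.eta, OrderIso.apply_symm_apply]
      exact Finset.mem_image.2 ⟨i, by simp, h2⟩
    · intro hh
      have hτ := run_lt hh
      rw [hlen] at hτ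
      rw [hrun τ hτ] at hh
      obtain ⟨i, hi, hi2⟩ := Finset.mem_image.1 hh
      simp only [Finset.mem_filter, Finset.mem_univ, true_and] at hi
      refine ⟨i, ?_⟩
      simp only [f, Prod.mk.injEq]
      refine ⟨?_, hi2⟩
      have : (⟨_, hmemV i⟩ : V) = e ⟨τ, hτ⟩ := Subtype.ext hi
      rw [this, OrderIso.symm_apply_apply]
  have hne : ∀ φ ∈ V, (Hf φ).Nonempty := by
    intro φ h
    obtain ⟨i, hi⟩ := hVex φ h
    exact ⟨_, Finset.mem_image.2 ⟨i, by simpa using hi, rfl⟩⟩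
  have hgne : ∀ φ ∈ V, (grp z φ).Nonempty := by
    intro φ h
    obtain ⟨i, hi⟩ := hVex φ h
    exact ⟨_, i, hi, rfl⟩
  have hruns : Runs S l := by
    constructor
    · intro H hH
      obtain ⟨k, rfl⟩ := List.mem_ofFn.1 hH
      exact ⟨hne _ (e k).2, by rw [hup]; exact hmin.cutConn _⟩
    · rw [List.isChain_iff_getElem]
      intro τ hτ
      have hτ' : τ + 1 < V.card := by rw [← hlen]; exact hτ
      simp only [l, List.getElem_ofFn]
      have hlt : (e ⟨τ, by omega⟩ : ℝ) < (e ⟨τ + 1, hτ'⟩ : ℝ) := by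
        have : e ⟨τ, by omega⟩ < e ⟨τ + 1, hτ'⟩ := e.lt_iff_lt.2 (by simp)
        exact this
      have hcons : ∀ i, Int.fract (z i) ≤ (e ⟨τ, by omega⟩ : ℝ) ∨ (e ⟨τ + 1, hτ'⟩ : ℝ) ≤ Int.fract (z i) := by
        intro i
        obtain ⟨k, hk⟩ := e.surjective ⟨_, hmemV i⟩
        have hk' : Int.fract (z i) = (e k : ℝ) := by rw [hk]
        rw [hk']
        rcases Nat.lt_or_ge τ k.1 with h | h
        · right
          have : e ⟨τ + 1, hτ'⟩ ≤ e k := e.le_iff_le.2 (by rw [Fin.le_def]; exact h)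
          exact this
        · left
          have : e k ≤ e ⟨τ, by omega⟩ := e.le_iff_le.2 (by rw [Fin.le_def]; exact h)
          exact this
      rcases hmin.rel hS _ _ hlt (hgne _ (e _).2) (hgne _ (e _).2) hcons with h | h
      · left
        obtain ⟨h1, hh1, h2, hh2, hlt⟩ := h
        rw [← hup] at hh1 hh2
        obtain ⟨a, ha, rfl⟩ := hh1
        obtain ⟨b, hb, rfl⟩ := hh2
        exact ⟨a, ha, b, hb, by omega⟩
      · right
        rw [hup, hup]; exact h
  have hVpos : 0 < V.card := Finset.card_pos.2 ⟨_, hmemV i0⟩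
  refine ⟨l, ⟨hruns, ?_⟩, f, hreal, ?_⟩
  · intro H hH
    have hH' : H = run l 0 := by
      unfold run
      cases hl : l with
      | nil => rw [hl] at hH; simp at hH
      | cons a t => rw [hl] at hH; simp at hH; simp [hH]
    rw [hH', hrun 0 hVpos]
    have h0 : (e ⟨0, hVpos⟩ : ℝ) = 0 := by
      apply le_antisymm
      · have hz0 : (0 : ℝ) ∈ V := by have := hmemV i0; rwa [hzi0, Int.fract_zero] at this
        obtain ⟨k, hk⟩ := e.surjective ⟨0, hz0⟩
        have : e ⟨0, hVpos⟩ ≤ e k := e.le_iff_le.2 (by rw [Fin.le_def]; exact Nat.zero_le _)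
        rw [hk] at this
        exact this
      · obtain ⟨i, hi⟩ := hVex _ (e ⟨0, hVpos⟩).2
        rw [← hi]; exact Int.fract_nonneg _
    rw [h0]
    refine Finset.mem_image.2 ⟨i0, ?_, ?_⟩ <;> simp [hzi0]
  · intro a b s hs
    rw [← hzx a b s hs]
    have hT : (0 : ℝ) < (l.length : ℝ) := by rw [hlen]; exact_mod_cast hVpos
    have hlt : ∀ i, (f i).1 < l.length := fun i => by rw [hlen]; exact (e.symm ⟨_, hmemV i⟩).2
    have hh : ∀ i, (((f i).2 : ℕ) : ℝ) = ((⌊z i⌋ : ℤ) : ℝ) := by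
      intro i
      have : (((⌊z i⌋.toNat : ℕ) : ℤ)) = ⌊z i⌋ := Int.toNat_of_nonneg (hfl i)
      show ((⌊z i⌋.toNat : ℕ) : ℝ) = _
      exact_mod_cast congrArg (Int.cast : ℤ → ℝ) this
    have e1 : pos l f b - pos l f a = ((⌊z b⌋ - ⌊z a⌋ : ℤ) : ℝ) +
        (((f b).1 : ℝ) / l.length - ((f a).1 : ℝ) / l.length) := by
      unfold pos
      rw [hh, hh]
      push_cast; ring
    have e2 : z b - z a = ((⌊z b⌋ - ⌊z a⌋ : ℤ) : ℝ) + (Int.fract (z b) - Int.fract (z a)) := by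
      have h2 := Int.floor_add_fract (z b)
      have h3 := Int.floor_add_fract (z a)
      push_cast; linarith
    rw [e1, e2]
    have hp0 : ∀ i, 0 ≤ ((f i).1 : ℝ) / l.length := fun i => by positivity
    have hp1 : ∀ i, ((f i).1 : ℝ) / l.length < 1 := fun i => by
      rw [div_lt_one hT]; exact_mod_cast hlt i
    refine cmp_frac s _ (hp0 a) (hp1 a) (hp0 b) (hp1 b) (Int.fract_nonneg _) (Int.fract_lt_one _)
      (Int.fract_nonneg _) (Int.fract_lt_one _) ?_
    rw [div_le_div_iff_of_pos_right hT, Nat.cast_le]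
    have : (e.symm ⟨_, hmemV a⟩ ≤ e.symm ⟨_, hmemV b⟩) ↔ Int.fract (z a) ≤ Int.fract (z b) := by
      rw [e.symm.le_iff_le]
      exact Iff.rfl
    exact this

lemma hyp_inj {n : ℕ} {i j i' j' : Fin n} {s s' : ℝ} (hij : i ≠ j)
    (h : hyp n i j s = hyp n i' j' s') :
    (i' = i ∧ j' = j ∧ s' = s) ∨ (i' = j ∧ j' = i ∧ s' = -s) := by
  have hp : ∀ v : Fin n → ℝ, Function.update v i (s + v j) i' - Function.update v i (s + v j) j' = s' := by
    intro v
    have : Function.update v i (s + v j) ∈ hyp n i j s := by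
      show _ - _ = _
      rw [Function.update_self, Function.update_of_ne hij.symm]; ring
    rw [h] at this
    exact this
  have hc := hp 0
  by_cases h1 : i' = j'
  · exfalso
    subst h1
    rw [sub_self] at hc
    have : Function.update (0 : Fin n → ℝ) i (s + 1) ∈ hyp n i' i' s' := by
      show _ - _ = _
      rw [sub_self]; exact hc
    rw [← h] at this
    have h2 : Function.update (0 : Fin n → ℝ) i (s + 1) i - Function.update (0 : Fin n → ℝ) i (s + 1) j = s := this
    rw [Function.update_self, Function.update_of_ne hij.symm] at h2
    simp at h2
  · by_cases h2 : i' = i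
    · left
      subst h2
      have h3 : s' = s := by
        rw [Function.update_self, Function.update_of_ne (Ne.symm h1)] at hc
        simp at hc
        exact hc.symm
      refine ⟨rfl, ?_, h3⟩
      by_contra h4
      have := hp (Pi.single j' 1)
      rw [Function.update_self, Function.update_of_ne (Ne.symm h1), Pi.single_eq_same,
        Pi.single_eq_of_ne (Ne.symm h4)] at this
      linarith
    · by_cases h3 : j' = i
      · right
        subst h3
        have h3 : s' = -s := by
          rw [Function.update_self, Function.update_of_ne h1] at hc
          simp at hc
          exact hc.symm
        refine ⟨?_, rfl, h3⟩
        by_contra h4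
        have := hp (Pi.single i' 1)
        rw [Function.update_self, Function.update_of_ne h1, Pi.single_eq_same,
          Pi.single_eq_of_ne (Ne.symm h4)] at this
        linarith
      · exfalso
        have := hp (Pi.single i' 1)
        rw [Function.update_of_ne h2, Function.update_of_ne h3] at this hc
        rw [Pi.single_eq_same, Pi.single_eq_of_ne (Ne.symm h1)] at this
        simp at hc
        linarith

def PC {n : ℕ} (i j : Fin n) (s : ℝ) (y x : Fin n → ℝ) : Prop :=
  (s ≤ y i - y j ↔ s ≤ x i - x j) ∧ (y i - y j ≤ s ↔ x i - x j ≤ s)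

lemma SEq_iff {S : Set ℤ} (hS : Good S) {n : ℕ} (y x : Fin n → ℝ) :
    SEq S y x ↔ ∀ i j : Fin n, ∀ s ∈ S, i < j → PC i j (s : ℝ) y x := by
  constructor
  · intro h i j s hs _
    refine ⟨h j i s hs, ?_⟩
    have := h i j (-s) (hS.sym s hs)
    push_cast at this
    constructor <;> intro h1
    · have := this.1 (by linarith); linarith
    · have := this.2 (by linarith); linarith
  · intro h a b s hs
    rcases lt_trichotomy a b with h1 | h1 | h1
    · have := (h a b (-s) (hS.sym s hs) h1).2
      push_cast at this
      constructor <;> intro h1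
      · have := this.1 (by linarith); linarith
      · have := this.2 (by linarith); linarith
    · subst h1; simp
    · exact (h b a s hs h1).1

lemma side_iff {n : ℕ} {i j : Fin n} (hij : i ≠ j) {s : ℝ} {σ : Set (Fin n → ℝ)}
    (h : IsSideOf n σ (hyp n i j s)) {x : Fin n → ℝ} (hx : x ∈ σ) (y : Fin n → ℝ) :
    y ∈ σ ↔ PC i j s y x := by
  rcases h with rfl | ⟨i', j', s', hH, h⟩
  · have hx' : x i - x j = s := hx
    have : y ∈ hyp n i j s ↔ y i - y j = s := Iff.rfl
    rw [this, PC, hx']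
    simp only [le_refl, iff_true]
    constructor
    · intro h; rw [h]; simp
    · rintro ⟨h1, h2⟩; linarith
  · have key : σ = {x | x i - x j < s} ∨ σ = {x | s < x i - x j} := by
      rcases hyp_inj hij hH with ⟨rfl, rfl, rfl⟩ | ⟨rfl, rfl, rfl⟩
      · exact h
      · rcases h with rfl | rfl
        · right
          ext w
          simp only [Set.mem_setOf_eq]
          constructor <;> intro _ <;> linarith
        · left
          ext w
          simp only [Set.mem_setOf_eq]
          constructor <;> intro _ <;> linarith
    rcases key with rfl | rfl
    · have hx' : x i - x j < s := hx
      have : y ∈ {x : Fin n → ℝ | x i - x j < s} ↔ y i - y j < s := Iff.rfl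
      rw [this, PC]
      constructor
      · intro h
        exact ⟨by constructor <;> intro _ <;> linarith, by constructor <;> intro _ <;> linarith⟩
      · rintro ⟨h1, h2⟩
        by_contra h3
        have := h1.1 (by linarith)
        linarith
    · have hx' : s < x i - x j := hx
      have : y ∈ {x : Fin n → ℝ | s < x i - x j} ↔ s < y i - y j := Iff.rfl
      rw [this, PC]
      constructor
      · intro h
        exact ⟨by constructor <;> intro _ <;> linarith, by constructor <;> intro _ <;> linarith⟩
      · rintro ⟨h1, h2⟩
        by_contra h3
        have := h2.1 (by linarith)
        linarith

lemma PC_refl {n : ℕ} (i j : Fin n) (s : ℝ) (x : Fin n → ℝ) : PC i j s x x := ⟨Iff.rfl, Iff.rfl⟩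

theorem isFace_iff {S : Set ℤ} (hS : Good S) {n : ℕ} (F : Set (Fin n → ℝ)) :
    IsFace n (arrS S n) F ↔ ∃ x, F = {y | SEq S y x} := by
  constructor
  · rintro ⟨⟨x, hx⟩, σ, hσ, rfl⟩
    refine ⟨x, ?_⟩
    rw [Set.mem_iInter₂] at hx
    ext y
    rw [Set.mem_iInter₂]
    have : y ∈ {y | SEq S y x} ↔ SEq S y x := Iff.rfl
    rw [this, SEq_iff hS]
    constructor
    · intro h i j s hs hij
      have hm : hyp n i j (s : ℝ) ∈ arrS S n := ⟨i, j, s, hij, hs, rfl⟩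
      exact (side_iff hij.ne (hσ _ hm) (hx _ hm) y).1 (h _ hm)
    · rintro h H ⟨i, j, s, hij, hs, rfl⟩
      have hm : hyp n i j (s : ℝ) ∈ arrS S n := ⟨i, j, s, hij, hs, rfl⟩
      exact (side_iff hij.ne (hσ _ hm) (hx _ hm) y).2 (h i j s hs hij)
  · rintro ⟨x, rfl⟩
    refine ⟨⟨x, fun _ _ _ _ => Iff.rfl⟩, fun H => {y | ∀ i j : Fin n, ∀ s ∈ S, i < j →
      H = hyp n i j (s : ℝ) → PC i j (s : ℝ) y x}, ?_, ?_⟩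
    · rintro H ⟨i, j, s, hij, hs, rfl⟩
      have key : {y | ∀ i' j' : Fin n, ∀ s' ∈ S, i' < j' →
          hyp n i j (s : ℝ) = hyp n i' j' (s' : ℝ) → PC i' j' (s' : ℝ) y x} =
          {y | PC i j (s : ℝ) y x} := by
        ext y
        constructor
        · intro h
          exact h i j s hs hij rfl
        · intro h i' j' s' hs' hij' he
          rcases hyp_inj hij.ne he with ⟨rfl, rfl, h3⟩ | ⟨rfl, rfl, h3⟩
          · rw [h3]; exact h
          · exact absurd hij (lt_asymm hij')
      show IsSideOf n {y | ∀ i' j' : Fin n, ∀ s' ∈ S, i' < j' →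
          hyp n i j (s : ℝ) = hyp n i' j' (s' : ℝ) → PC i' j' (s' : ℝ) y x} _
      rw [key]
      rcases lt_trichotomy (x i - x j) s with h | h | h
      · right
        refine ⟨i, j, s, rfl, Or.inl ?_⟩
        ext y
        exact (side_iff hij.ne (σ := {x | x i - x j < s})
          (Or.inr ⟨i, j, s, rfl, Or.inl rfl⟩) h y).symm
      · left
        ext y
        exact (side_iff hij.ne (σ := hyp n i j s) (Or.inl rfl) h y).symm
      · right
        refine ⟨i, j, s, rfl, Or.inr ?_⟩
        ext y
        exact (side_iff hij.ne (σ := {x | s < x i - x j})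
          (Or.inr ⟨i, j, s, rfl, Or.inr rfl⟩) h y).symm
    · ext y
      rw [Set.mem_iInter₂]
      have : y ∈ {y | SEq S y x} ↔ SEq S y x := Iff.rfl
      rw [this, SEq_iff hS]
      constructor
      · rintro h H ⟨i, j, s, hij, hs, rfl⟩ i' j' s' hs' hij' _
        exact h i' j' s' hs' hij'
      · intro h i j s hs hij
        exact h (hyp n i j s) ⟨i, j, s, hij, hs, rfl⟩ i j s hs hij rfl

def Wsub (S : Set ℤ) {n : ℕ} (x : Fin n → ℝ) : Submodule ℝ (Fin n → ℝ) where
  carrier := {v | ∀ i j, (∃ s ∈ S, x i - x j = (s : ℝ)) → v i = v j}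
  add_mem' := by
    intro a b ha hb i j h
    simp only [Pi.add_apply]
    rw [ha i j h, hb i j h]
  zero_mem' := by intro i j _; rfl
  smul_mem' := by
    intro c a ha i j h
    simp only [Pi.smul_apply]
    rw [ha i j h]

theorem direction_eq {S : Set ℤ} (hS : Good S) (hfin : S.Finite) {n : ℕ} (x : Fin n → ℝ) :
    (affineSpan ℝ {y | SEq S y x}).direction = Wsub S x := by
  rw [direction_affineSpan]
  apply le_antisymm
  · rw [vectorSpan_def, Submodule.span_le]
    rintro v ⟨y, hy, y', hy', rfl⟩ i j ⟨s, hs, hij⟩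
    have aux : ∀ w : Fin n → ℝ, SEq S w x → w i - w j = s := by
      intro w hw
      apply le_antisymm
      · have := (hw i j (-s) (hS.sym s hs)).2 (by push_cast; linarith)
        push_cast at this; linarith
      · exact (hw j i s hs).2 hij.ge
    have h1 := aux y hy
    have h2 := aux y' hy'
    show y i - y' i = y j - y' j
    linarith
  · intro v hv
    have hev : ∀ᶠ ε in nhdsWithin (0 : ℝ) (Set.Ioi 0), SEq S (x + ε • v) x := by
      have : ∀ᶠ ε in nhdsWithin (0 : ℝ) (Set.Ioi 0), ∀ a b, ∀ s ∈ S,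
          ((s : ℝ) ≤ (x + ε • v) b - (x + ε • v) a ↔ (s : ℝ) ≤ x b - x a) := by
        rw [Filter.eventually_all]; intro a
        rw [Filter.eventually_all]; intro b
        rw [Filter.eventually_all_finite hfin]; intro s hs
        have hcont : Filter.Tendsto (fun ε : ℝ => (x + ε • v) b - (x + ε • v) a)
            (nhdsWithin (0 : ℝ) (Set.Ioi 0)) (nhds (x b - x a)) := by
          have hc : Continuous (fun ε : ℝ => (x + ε • v) b - (x + ε • v) a) := by
            simp only [Pi.add_apply, Pi.smul_apply, smul_eq_mul]; fun_prop
          have := hc.tendsto 0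
          simp only [zero_smul, add_zero] at this
          exact this.mono_left nhdsWithin_le_nhds
        rcases lt_trichotomy (s : ℝ) (x b - x a) with h | h | h
        · filter_upwards [hcont.eventually (Ioi_mem_nhds h)] with ε hε
          exact ⟨fun _ => h.le, fun _ => le_of_lt hε⟩
        · have hvv := hv b a ⟨s, hs, h.symm⟩
          refine Filter.Eventually.of_forall fun ε => ?_
          simp only [Pi.add_apply, Pi.smul_apply, smul_eq_mul, hvv, add_sub_add_right_eq_sub]
        · filter_upwards [hcont.eventually (Iio_mem_nhds h)] with ε hε
          have hε' : (x + ε • v) b - (x + ε • v) a < s := hε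
          constructor <;> intro _ <;> linarith
      exact this
    obtain ⟨ε, h1, h2⟩ := (hev.and self_mem_nhdsWithin).exists
    have h2' : (0 : ℝ) < ε := h2
    have h3 : (x + ε • v) -ᵥ x ∈ vectorSpan ℝ {y | SEq S y x} :=
      vsub_mem_vectorSpan ℝ h1 (fun _ _ _ _ => Iff.rfl : SEq S x x)
    have h4 : v = ε⁻¹ • ((x + ε • v) -ᵥ x) := by
      rw [vsub_eq_sub, add_sub_cancel_left, smul_smul, inv_mul_cancel₀ h2'.ne', one_smul]
    rw [h4]
    exact Submodule.smul_mem _ _ h3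

lemma finrank_fibre {n : ℕ} {β : Type*} [DecidableEq β] (k : Fin n → β) (W : Submodule ℝ (Fin n → ℝ))
    (hW : ∀ v, v ∈ W ↔ ∀ i j, k i = k j → v i = v j) :
    Module.finrank ℝ W = (Finset.univ.image k).card := by
  let k' : Fin n → (Finset.univ.image k : Finset β) := fun i => ⟨k i, Finset.mem_image_of_mem _ (Finset.mem_univ _)⟩
  have hk' : Function.Surjective k' := by
    rintro ⟨b, hb⟩
    obtain ⟨i, _, rfl⟩ := Finset.mem_image.1 hb
    exact ⟨i, rfl⟩
  have hr : W = LinearMap.range (LinearMap.funLeft ℝ ℝ k') := by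
    ext v
    rw [hW, LinearMap.mem_range]
    constructor
    · intro h
      refine ⟨fun b => v (Function.surjInv hk' b), ?_⟩
      funext i
      show v (Function.surjInv hk' (k' i)) = v i
      apply h
      exact congrArg Subtype.val (Function.surjInv_eq hk' (k' i))
    · rintro ⟨g, rfl⟩ i j hij
      show g (k' i) = g (k' j)
      congr 1
      exact Subtype.ext hij
  rw [hr, LinearMap.finrank_range_of_inj (LinearMap.funLeft_injective_of_surjective ℝ ℝ k' hk')]
  simp

theorem faceDim_eq {S : Set ℤ} (hS : Good S) (hfin : S.Finite) {l : List (Finset ℕ)} (hl : Normal S l)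
    {n : ℕ} (f : Fin n → ℕ × ℕ) (hf : Realises f l) :
    faceDim n {y | SEq S y (pos l f)} = dimf S l f := by
  unfold faceDim dimf
  rw [direction_eq hS hfin]
  apply finrank_fibre
  intro v
  have hmem : ∀ i, (f i).2 ∈ run l (f i).1 := fun i => (hf (f i).1 (f i).2).1 ⟨i, rfl⟩
  have hlt : ∀ i, (f i).1 < l.length := fun i => run_lt (hmem i)
  have hdiff : ∀ i j, (f i).1 = (f j).1 →
      pos l f i - pos l f j = ((((f i).2 : ℤ) - ((f j).2 : ℤ) : ℤ) : ℝ) := by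
    intro i j h
    unfold pos
    rw [h]; push_cast; ring
  constructor
  · intro hv i j hij
    unfold kap at hij
    split_ifs at hij with h1 h2
    · have ht : (f i).1 = (f j).1 := Sum.inl.inj hij
      set τ := (f i).1 with hτ
      have hcc := hl.1.run_cc τ (hlt i)
      have hex : ∀ h : ℤ, ∃ k : Fin n, h ∈ up (run l τ) → (f k).1 = τ ∧ ((f k).2 : ℤ) = h := by
        intro h
        by_cases hh : h ∈ up (run l τ)
        · obtain ⟨h', hh', rfl⟩ := hh
          obtain ⟨k, hk⟩ := (hf τ h').2 hh'
          exact ⟨k, fun _ => by rw [hk]; exact ⟨rfl, rfl⟩⟩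
        · exact ⟨i, fun h => absurd h hh⟩
      choose J hJ using hex
      have hcol := two_colour hS hcc (fun h => v (J h)) (by
        intro a ha b hb hab
        have h3 := hJ a ha
        have h4 := hJ b hb
        apply Eq.symm
        apply hv
        refine ⟨b - a, hab, ?_⟩
        rw [hdiff _ _ (h4.1.trans h3.1.symm), h3.2, h4.2])
      have hnb : ∀ k, (f k).1 = τ → ∃ p ∈ up (run l τ), v k = v (J p) := by
        intro k hk
        have hkm : (f k).2 ∈ run l τ := by rw [← hk]; exact hmem k
        have hku : ((f k).2 : ℤ) ∈ up (run l τ) := ⟨_, hkm, rfl⟩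
        have : ∃ u ∈ up (run l τ), ((f k).2 : ℤ) - u ∈ S := by
          rcases h1 with h1 | h1
          · obtain ⟨e, he, hne⟩ : ∃ e ∈ run l τ, e ≠ (f k).2 := by
              by_contra hcon
              push Not at hcon
              apply h1
              rw [Finset.card_eq_one]
              exact ⟨(f k).2, Finset.eq_singleton_iff_unique_mem.2 ⟨hkm, hcon⟩⟩
            rcases lt_or_gt_of_ne hne with h3 | h3
            · exact lemmaP hS hcc (a0 := e) (b0 := (f k).2) ⟨_, he, rfl⟩ hku (by omega) le_rfl (Or.inl (by omega))
            · exact lemmaP hS hcc (a0 := (f k).2) (b0 := e) hku ⟨_, he, rfl⟩ le_rfl (by omega) (Or.inl (by omega))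
          · exact ⟨_, hku, by simpa using h1⟩
        obtain ⟨p, hp, hpS⟩ := this
        refine ⟨p, hp, hv _ _ ⟨_, hpS, ?_⟩⟩
        have h4 := hJ p hp
        rw [hdiff _ _ (hk.trans h4.1.symm), h4.2]
      obtain ⟨p, hp, e1⟩ := hnb i rfl
      obtain ⟨q, hq, e2⟩ := hnb j ht.symm
      rw [e1, e2]
      exact hcol p hp q hq
    · rw [Sum.inr.inj hij]
  · intro hv i j hij
    obtain ⟨s, hs, hij⟩ := hij
    have hT : (0 : ℝ) < l.length := by have := hlt i; exact_mod_cast (by omega)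
    have ht : (f i).1 = (f j).1 := by
      unfold pos at hij
      have h1 : ((l.length : ℤ) * ((f i).2 - (f j).2 - s) : ℤ) = (f j).1 - (f i).1 := by
        have : (l.length : ℝ) * ((f i).2 - (f j).2 - s) = (f j).1 - (f i).1 := by
          field_simp at hij
          linarith
        exact_mod_cast this
      have h2 := hlt i
      have h3 := hlt j
      have h4 : ((f i).2 - (f j).2 - s : ℤ) = 0 := by
        by_contra h5
        rcases lt_or_gt_of_ne h5 with h5 | h5
        · nlinarith
        · nlinarith
      rw [h4, mul_zero] at h1
      omega
    apply hv
    have hd := hdiff i j ht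
    rw [hij] at hd
    have hd' : s = ((f i).2 : ℤ) - ((f j).2 : ℤ) := by exact_mod_cast hd
    unfold kap
    by_cases hb : bigT S l (f i).1
    · rw [if_pos hb, if_pos (by rw [← ht]; exact hb), ht]
    · exfalso
      unfold bigT at hb
      push Not at hb
      obtain ⟨hb1, hb2⟩ := hb
      obtain ⟨a, ha⟩ := Finset.card_eq_one.1 hb1
      have h1 := hmem i
      have h2 := hmem j
      rw [← ht] at h2
      rw [ha, Finset.mem_singleton] at h1 h2
      apply hb2
      have : s = 0 := by rw [hd', h1, h2]; simp
      rwa [this] at hs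

lemma up_insert (a : ℕ) (pre : Finset ℕ) : up (insert a pre) = insert (a : ℤ) (up pre) := by
  ext z
  simp only [up, Set.mem_insert_iff]
  constructor
  · rintro ⟨h, hh, rfl⟩
    rcases Finset.mem_insert.1 hh with rfl | hh
    · exact Or.inl rfl
    · exact Or.inr ⟨h, hh, rfl⟩
  · rintro (rfl | ⟨h, hh, rfl⟩)
    · exact ⟨a, Finset.mem_insert_self _ _, rfl⟩
    · exact ⟨h, Finset.mem_insert_of_mem hh, rfl⟩

lemma up_singleton (a : ℕ) : up {a} = {(a : ℤ)} := by
  ext z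
  constructor
  · rintro ⟨h, hh, rfl⟩
    rw [Finset.mem_singleton.1 hh]; rfl
  · intro h
    exact ⟨a, Finset.mem_singleton_self _, (h : z = a).symm⟩

lemma mem_up {a : ℕ} {pre : Finset ℕ} : (a : ℤ) ∈ up pre ↔ a ∈ pre := by
  constructor
  · rintro ⟨h, hh, he⟩
    rwa [← Int.natCast_inj.1 he]
  · intro h; exact ⟨a, h, rfl⟩

lemma cc_singleton (S : Set ℤ) (a : ℤ) : CutConn S {a} := by
  rintro c ⟨x, hx, h1⟩ ⟨y, hy, h2⟩
  have hx' : x = a := hx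
  have hy' : y = a := hy
  omega

lemma cc_insert_max {S U : Set ℤ} {c e : ℤ} (hc : c ∈ U) (hmax : ∀ a ∈ U, a ≤ c) (he : c < e)
    (hU : CutConn S U) : CutConn S (insert e U) ↔ ∃ a ∈ U, e - a ∈ S := by
  constructor
  · intro h
    obtain ⟨a, ha, b, hb, h1, h2, h3⟩ := h c ⟨c, Or.inr hc, le_rfl⟩ ⟨e, Or.inl rfl, he⟩
    have hb' : b = e := by
      rcases hb with hb | hb
      · exact hb
      · have := hmax b hb; omega
    have ha' : a ∈ U := by
      rcases ha with ha | ha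
      · omega
      · exact ha
    exact ⟨a, ha', hb' ▸ h3⟩
  · rintro ⟨a, ha, haS⟩ k ⟨x, hx, hxk⟩ ⟨y, hy, hyk⟩
    have hke : k < e := by
      rcases hy with hy | hy
      · omega
      · have := hmax y hy; omega
    by_cases hak : a ≤ k
    · exact ⟨a, Or.inr ha, e, Or.inl rfl, hak, hke, haS⟩
    · have hx' : x ∈ U := by
        rcases hx with hx | hx
        · omega
        · exact hx
      obtain ⟨a', ha', b', hb', h⟩ := hU k ⟨x, hx', hxk⟩ ⟨a, ha, by omega⟩
      exact ⟨a', Or.inr ha', b', Or.inr hb', h⟩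

lemma cc_skip {S U : Set ℤ} {c p e : ℤ} (hc : c ∈ U) (hmax : ∀ a ∈ U, a ≤ c)
    (hp : c < p) (he : p < e) (hU : ¬ CutConn S (insert p U)) :
    CutConn S (insert e (insert p U)) ↔ CutConn S (insert e U) := by
  constructor
  · intro h
    have hk0 : ∃ k0, (∃ a ∈ insert p U, a ≤ k0) ∧ (∃ b ∈ insert p U, k0 < b) ∧
        ∀ a ∈ insert p U, ∀ b ∈ insert p U, a ≤ k0 → k0 < b → b - a ∉ S := by
      by_contra hcon
      apply hU
      intro k ha hb
      by_contra h2
      apply hcon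
      refine ⟨k, ha, hb, fun a ha' b hb' h3 h4 h5 => h2 ⟨a, ha', b, hb', h3, h4, h5⟩⟩
    obtain ⟨k0, ⟨x, hx, hxk⟩, ⟨y, hy, hyk⟩, hno⟩ := hk0
    have hk0p : k0 < p := by
      rcases hy with hy | hy
      · omega
      · have := hmax y hy; omega
    obtain ⟨a, ha, b, hb, h1, h2, h3⟩ := h k0 ⟨x, Or.inr hx, hxk⟩ ⟨e, Or.inl rfl, by omega⟩
    have ha' : a ∈ U := by
      rcases ha with ha | ha | ha
      · omega
      · omega
      · exact ha
    have hb' : b = e := by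
      rcases hb with hb | hb
      · exact hb
      · exact absurd h3 (hno a (Or.inr ha') b hb h1 h2)
    subst hb'
    rintro k ⟨w, hw, hwk⟩ ⟨v, hv, hvk⟩
    have hke : k < b := by
      rcases hv with hv | hv
      · omega
      · have := hmax v hv; omega
    by_cases hak : a ≤ k
    · exact ⟨a, Or.inr ha', b, Or.inl rfl, hak, hke, h3⟩
    have hw' : w ∈ U := by
      rcases hw with hw | hw
      · omega
      · exact hw
    obtain ⟨a1, ha1, b1, hb1, h4, h5, h6⟩ := h k ⟨w, Or.inr (Or.inr hw'), hwk⟩ ⟨b, Or.inl rfl, hke⟩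
    have hac := hmax a ha'
    have ha1' : a1 ∈ U := by
      rcases ha1 with ha1 | ha1 | ha1
      · omega
      · omega
      · exact ha1
    rcases hb1 with hb1 | hb1 | hb1
    · exact ⟨a1, Or.inr ha1', b1, Or.inl hb1, h4, h5, h6⟩
    · exact absurd h6 (hno a1 (Or.inr ha1') b1 (Or.inl hb1) (by omega) (by omega))
    · exact ⟨a1, Or.inr ha1', b1, Or.inr hb1, h4, h5, h6⟩
  · rintro h k ⟨x, hx, hxk⟩ ⟨y, hy, hyk⟩
    have hex : ∃ a ∈ insert e U, a ≤ k := by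
      rcases hx with hx | hx | hx
      · exact ⟨x, Or.inl hx, hxk⟩
      · exact ⟨c, Or.inr hc, by omega⟩
      · exact ⟨x, Or.inr hx, hxk⟩
    have hey : ∃ a ∈ insert e U, k < a := by
      rcases hy with hy | hy | hy
      · exact ⟨y, Or.inl hy, hyk⟩
      · exact ⟨e, Or.inl rfl, by omega⟩
      · exact ⟨y, Or.inr hy, hyk⟩
    obtain ⟨a, ha, b, hb, h'⟩ := h k hex hey
    refine ⟨a, ?_, b, ?_, h'⟩
    · rcases ha with ha | ha
      · exact Or.inl ha
      · exact Or.inr (Or.inr ha)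
    · rcases hb with hb | hb
      · exact Or.inl hb
      · exact Or.inr (Or.inr hb)

/-- States of the automaton. -/
structure AState (m : ℕ) where
  single : Prop
  cc : Prop
  sat : Prop
  al : Fin (m + 1) → Prop
  be : Fin (m + 1) → Prop
  ga : Fin (m + 1) → Prop

lemma AState.ext' {m : ℕ} {σ τ : AState m} (h1 : σ.single ↔ τ.single) (h2 : σ.cc ↔ τ.cc)
    (h3 : σ.sat ↔ τ.sat) (h4 : ∀ d, σ.al d ↔ τ.al d) (h5 : ∀ d, σ.be d ↔ τ.be d)
    (h6 : ∀ d, σ.ga d ↔ τ.ga d) : σ = τ := by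
  cases σ; cases τ
  simp only [AState.mk.injEq]
  exact ⟨propext h1, propext h2, propext h3, funext fun d => propext (h4 d),
    funext fun d => propext (h5 d), funext fun d => propext (h6 d)⟩

noncomputable instance (m : ℕ) : Fintype (AState m) :=
  Fintype.ofInjective (fun σ : AState m => (σ.single, σ.cc, σ.sat, σ.al, σ.be, σ.ga)) (by
    intro σ τ h
    cases σ; cases τ
    simp only [Prod.mk.injEq] at h
    simp only [AState.mk.injEq]
    exact h)

def ix {m : ℕ} (p : Fin (m + 1) → Prop) (d : ℕ) : Prop := ∃ h : d < m + 1, p ⟨d, h⟩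

def rs (m : ℕ) (P : ℕ → Prop) : Fin (m + 1) → Prop := fun d => P d.1

lemma ix_rs {m : ℕ} {P : ℕ → Prop} {d : ℕ} : ix (rs m P) d ↔ d < m + 1 ∧ P d :=
  ⟨fun ⟨h, h'⟩ => ⟨h, h'⟩, fun ⟨h, h'⟩ => ⟨h, h'⟩⟩

noncomputable def trA (S : Set ℤ) {m : ℕ} (σ : AState m) (δ : ℕ) : AState m where
  single := False
  cc := ix σ.al δ
  sat := σ.sat ∨ ix σ.ga δ
  be := rs m fun d => ix σ.be (d + δ) ∨ (d : ℤ) ∈ S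
  al := rs m fun d => 1 ≤ d ∧ ((ix σ.al δ ∧ (ix σ.be (d + δ) ∨ (d : ℤ) ∈ S)) ∨
    (¬ ix σ.al δ ∧ ix σ.al (d + δ)))
  ga := rs m fun d => ix σ.ga (d + δ)

noncomputable def nwA (S : Set ℤ) {m : ℕ} (σ : AState m) (δ : ℕ) : AState m where
  single := True
  cc := True
  sat := ix σ.be δ
  be := rs m fun d => (d : ℤ) ∈ S
  al := rs m fun d => 1 ≤ d ∧ (d : ℤ) ∈ S
  ga := rs m fun d => ix σ.be (d + δ)

noncomputable def s0A (S : Set ℤ) (m : ℕ) : AState m where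
  single := True
  cc := True
  sat := True
  be := rs m fun d => (d : ℤ) ∈ S
  al := rs m fun d => 1 ≤ d ∧ (d : ℤ) ∈ S
  ga := rs m fun _ => False

noncomputable def piA (S : Set ℤ) (m : ℕ) (G : Option (Finset ℕ)) (pre : Finset ℕ) (c : ℕ) : AState m where
  single := pre.card = 1
  cc := CutConn S (up pre)
  sat := ∀ g ∈ G, Rel S (up g) (up pre)
  be := rs m fun d => ∃ a ∈ pre, ((c + d : ℕ) : ℤ) - (a : ℤ) ∈ S
  al := rs m fun d => 1 ≤ d ∧ CutConn S (up (insert (c + d) pre))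
  ga := rs m fun d => ∃ g ∈ G, ∃ a ∈ g, ((c + d : ℕ) : ℤ) - (a : ℤ) ∈ S

lemma ix_al {S : Set ℤ} {m : ℕ} {G : Option (Finset ℕ)} {pre : Finset ℕ} {c d : ℕ} :
    ix (piA S m G pre c).al d ↔ d < m + 1 ∧ 1 ≤ d ∧ CutConn S (up (insert (c + d) pre)) :=
  ⟨fun ⟨h, h'⟩ => ⟨h, h'⟩, fun ⟨h, h'⟩ => ⟨h, h'⟩⟩

lemma ix_be {S : Set ℤ} {m : ℕ} {G : Option (Finset ℕ)} {pre : Finset ℕ} {c d : ℕ} :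
    ix (piA S m G pre c).be d ↔ d < m + 1 ∧ ∃ a ∈ pre, ((c + d : ℕ) : ℤ) - (a : ℤ) ∈ S :=
  ⟨fun ⟨h, h'⟩ => ⟨h, h'⟩, fun ⟨h, h'⟩ => ⟨h, h'⟩⟩

lemma ix_ga {S : Set ℤ} {m : ℕ} {G : Option (Finset ℕ)} {pre : Finset ℕ} {c d : ℕ} :
    ix (piA S m G pre c).ga d ↔ d < m + 1 ∧ ∃ g ∈ G, ∃ a ∈ g, ((c + d : ℕ) : ℤ) - (a : ℤ) ∈ S :=
  ⟨fun ⟨h, h'⟩ => ⟨h, h'⟩, fun ⟨h, h'⟩ => ⟨h, h'⟩⟩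

lemma cc_pair {S : Set ℤ} (b d : ℕ) (hd : 1 ≤ d) : CutConn S (up (insert (b + d) {b})) ↔ (d : ℤ) ∈ S := by
  rw [up_insert, up_singleton, cc_insert_max (U := {(b : ℤ)}) (c := (b : ℤ)) rfl (fun a ha => (ha : a = b).le)
    (by push_cast; omega) (cc_singleton S _)]
  constructor
  · rintro ⟨a, ha, h⟩
    have ha' : a = b := ha
    subst ha'
    push_cast at h
    rwa [add_sub_cancel_left] at h
  · intro h
    refine ⟨b, rfl, ?_⟩
    push_cast
    rwa [add_sub_cancel_left]

lemma piA_none (S : Set ℤ) (m b : ℕ) : piA S m none {b} b = s0A S m := by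
  apply AState.ext'
  · simp [piA, s0A]
  · simp only [piA, s0A, iff_true]
    rw [up_singleton]; exact cc_singleton S _
  · simp [piA, s0A]
  · intro d
    show 1 ≤ d.1 ∧ _ ↔ 1 ≤ d.1 ∧ _
    exact and_congr_right fun h => cc_pair b d.1 h
  · intro d
    show (∃ a ∈ ({b} : Finset ℕ), _) ↔ _
    simp [s0A, rs]
  · intro d
    show (∃ g ∈ (none : Option (Finset ℕ)), _) ↔ False
    simp

lemma piA_new {S : Set ℤ} (hS : Good S) {m : ℕ} (hm : ∀ s ∈ S, s ≤ m) (G : Option (Finset ℕ))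
    (pre : Finset ℕ) (c : ℕ) (hmax : ∀ a ∈ pre, a ≤ c) (δ : ℕ) (hδ : δ < m + 1) :
    piA S m (some pre) {c + δ} (c + δ) = nwA S (piA S m G pre c) δ := by
  apply AState.ext'
  · simp [piA, nwA]
  · simp only [piA, nwA, iff_true]
    rw [up_singleton]; exact cc_singleton S _
  · show (∀ g ∈ some pre, Rel S (up g) (up {c + δ})) ↔ ix (piA S m G pre c).be δ
    rw [ix_be]
    simp only [Option.mem_some_iff, forall_eq']
    constructor
    · rintro ⟨u, ⟨a, ha, rfl⟩, v, ⟨w, hw, rfl⟩, h⟩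
      rw [Finset.mem_singleton] at hw
      subst hw
      exact ⟨hδ, a, ha, hS.sym' h⟩
    · rintro ⟨_, a, ha, h⟩
      exact ⟨a, ⟨a, ha, rfl⟩, _, ⟨_, Finset.mem_singleton_self _, rfl⟩, hS.sym' h⟩
  · intro d
    show 1 ≤ d.1 ∧ _ ↔ 1 ≤ d.1 ∧ _
    exact and_congr_right fun h => cc_pair (c + δ) d.1 h
  · intro d
    show (∃ a ∈ ({c + δ} : Finset ℕ), _) ↔ _
    simp [nwA, rs]
  · intro d
    show (∃ g ∈ some pre, ∃ a ∈ g, ((c + δ + d.1 : ℕ) : ℤ) - (a : ℤ) ∈ S) ↔ ix (piA S m G pre c).be (d.1 + δ)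
    rw [ix_be]
    simp only [Option.mem_some_iff, exists_eq_left']
    constructor
    · rintro ⟨a, ha, h⟩
      have h1 := hm _ h
      have h2 := hmax a ha
      refine ⟨by push_cast at h1; omega, a, ha, ?_⟩
      rwa [show c + (d.1 + δ) = c + δ + d.1 by omega]
    · rintro ⟨_, a, ha, h⟩
      refine ⟨a, ha, ?_⟩
      rwa [show c + (d.1 + δ) = c + δ + d.1 by omega] at h

lemma piA_tr {S : Set ℤ} (hS : Good S) {m : ℕ} (hm : ∀ s ∈ S, s ≤ m) (G : Option (Finset ℕ))
    (pre : Finset ℕ) (c : ℕ) (hc : c ∈ pre) (hmax : ∀ a ∈ pre, a ≤ c)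
    (hG : ∀ g ∈ G, ∀ a ∈ g, a ≤ c) (δ : ℕ) (hδ : δ < m + 1) (hδ1 : 1 ≤ δ) :
    piA S m G (insert (c + δ) pre) (c + δ) = trA S (piA S m G pre c) δ := by
  have hnot : c + δ ∉ pre := fun h => by have := hmax _ h; omega
  have hbe : ∀ d : ℕ, (∃ a ∈ insert (c + δ) pre, ((c + δ + d : ℕ) : ℤ) - (a : ℤ) ∈ S) ↔
      (ix (piA S m G pre c).be (d + δ) ∨ (d : ℤ) ∈ S) := by
    intro d
    have e1 : ix (piA S m G pre c).be (d + δ) ↔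
        d + δ < m + 1 ∧ ∃ a ∈ pre, ((c + (d + δ) : ℕ) : ℤ) - (a : ℤ) ∈ S := ix_be
    rw [e1]
    constructor
    · rintro ⟨a, ha, h⟩
      rcases Finset.mem_insert.1 ha with rfl | ha
      · right
        push_cast at h
        rwa [add_sub_cancel_left] at h
      · left
        have h1 := hm _ h
        have h2 := hmax a ha
        refine ⟨by push_cast at h1; omega, a, ha, ?_⟩
        rwa [show c + (d + δ) = c + δ + d by omega]
    · rintro (⟨_, a, ha, h⟩ | h)
      · refine ⟨a, Finset.mem_insert_of_mem ha, ?_⟩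
        rwa [show c + (d + δ) = c + δ + d by omega] at h
      · refine ⟨c + δ, Finset.mem_insert_self _ _, ?_⟩
        push_cast
        rwa [add_sub_cancel_left]
  have hal : ix (piA S m G pre c).al δ ↔ CutConn S (up (insert (c + δ) pre)) := by
    have e1 : ix (piA S m G pre c).al δ ↔ δ < m + 1 ∧ 1 ≤ δ ∧ CutConn S (up (insert (c + δ) pre)) := ix_al
    rw [e1]
    exact ⟨fun h => h.2.2, fun h => ⟨hδ, hδ1, h⟩⟩
  have hupmax : ∀ z ∈ up pre, z ≤ (c : ℤ) := by
    rintro z ⟨a, ha, rfl⟩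
    exact_mod_cast hmax a ha
  apply AState.ext'
  · show (insert (c + δ) pre).card = 1 ↔ False
    rw [Finset.card_insert_of_notMem hnot]
    have := Finset.card_pos.2 ⟨c, hc⟩
    simp only [iff_false]
    omega
  · exact hal.symm
  · show (∀ g ∈ G, Rel S (up g) (up (insert (c + δ) pre))) ↔ (∀ g ∈ G, Rel S (up g) (up pre)) ∨ ix (piA S m G pre c).ga δ
    rw [ix_ga]
    cases G with
    | none => simp
    | some g =>
      simp only [Option.mem_some_iff, forall_eq', exists_eq_left']
      constructor
      · rintro ⟨u, ⟨a, ha, rfl⟩, v, ⟨w, hw, rfl⟩, h⟩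
        rcases Finset.mem_insert.1 hw with rfl | hw
        · exact Or.inr ⟨hδ, a, ha, hS.sym' h⟩
        · exact Or.inl ⟨_, ⟨a, ha, rfl⟩, _, ⟨w, hw, rfl⟩, h⟩
      · rintro (⟨u, hu, v, ⟨w, hw, rfl⟩, h⟩ | ⟨_, a, ha, h⟩)
        · exact ⟨u, hu, _, ⟨w, Finset.mem_insert_of_mem hw, rfl⟩, h⟩
        · exact ⟨_, ⟨a, ha, rfl⟩, _, ⟨_, Finset.mem_insert_self _ _, rfl⟩, hS.sym' h⟩
  · intro d
    show (1 ≤ d.1 ∧ CutConn S (up (insert (c + δ + d.1) (insert (c + δ) pre)))) ↔ 1 ≤ d.1 ∧ _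
    refine and_congr_right fun hd => ?_
    by_cases h1 : CutConn S (up (insert (c + δ) pre))
    · have h2 := hal.2 h1
      rw [← hbe d.1]
      simp only [h2, true_and, not_true_eq_false, false_and, or_false]
      rw [up_insert, cc_insert_max (c := ((c + δ : ℕ) : ℤ)) (mem_up.2 (Finset.mem_insert_self _ _)) ?_ (by push_cast; omega) h1]
      · constructor
        · rintro ⟨_, ⟨a, ha, rfl⟩, h⟩
          exact ⟨a, ha, h⟩
        · rintro ⟨a, ha, h⟩
          exact ⟨a, ⟨a, ha, rfl⟩, h⟩
      · rw [up_insert]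
        rintro z (rfl | hz)
        · exact le_rfl
        · have := hupmax z hz; push_cast; omega
    · have h2 : ¬ ix (piA S m G pre c).al δ := fun h => h1 (hal.1 h)
      simp only [h2, false_and, not_false_eq_true, true_and, false_or]
      have e1 : ix (piA S m G pre c).al (d.1 + δ) ↔
          d.1 + δ < m + 1 ∧ 1 ≤ d.1 + δ ∧ CutConn S (up (insert (c + (d.1 + δ)) pre)) := ix_al
      rw [e1, up_insert, up_insert, cc_skip (mem_up.2 hc) hupmax (by push_cast; omega) (by push_cast; omega)
        (by rw [← up_insert]; exact h1), ← up_insert, show c + (d.1 + δ) = c + δ + d.1 by omega]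
      constructor
      · intro h
        refine ⟨?_, by omega, h⟩
        rw [up_insert] at h
        obtain ⟨a, ha, b, hb, h3, h4, h5⟩ := h c ⟨c, Or.inr (mem_up.2 hc), le_rfl⟩
          ⟨_, Or.inl rfl, by push_cast; omega⟩
        have h6 := hm _ h5
        have hb' : b = ((c + δ + d.1 : ℕ) : ℤ) := by
          rcases hb with hb | hb
          · exact hb
          · have := hupmax b hb; omega
        push_cast at hb'
        omega
      · rintro ⟨_, _, h⟩
        exact h
  · intro d
    exact hbe d.1
  · intro d
    show (∃ g ∈ G, ∃ a ∈ g, ((c + δ + d.1 : ℕ) : ℤ) - (a : ℤ) ∈ S) ↔ ix (piA S m G pre c).ga (d.1 + δ)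
    rw [ix_ga]
    constructor
    · rintro ⟨g, hg, a, ha, h⟩
      have h1 := hm _ h
      have h2 := hG g hg a ha
      refine ⟨by push_cast at h1; omega, g, hg, a, ha, ?_⟩
      rwa [show c + (d.1 + δ) = c + δ + d.1 by omega]
    · rintro ⟨_, g, hg, a, ha, h⟩
      refine ⟨g, hg, a, ha, ?_⟩
      rwa [show c + (d.1 + δ) = c + δ + d.1 by omega] at h

def HasFS {ι R : Type*} [CommRing R] (P : ι → Prop) (W : ι → R) (a : R) : Prop :=
  ∃ t : Finset ι, (∀ x, x ∈ t ↔ P x) ∧ ∑ x ∈ t, W x = a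

section HasFS
variable {ι κ R : Type*} [CommRing R]

lemma HasFS.congr {P Q : ι → Prop} {W : ι → R} {a b : R} (h : HasFS P W a) (hPQ : ∀ x, P x ↔ Q x)
    (hab : a = b) : HasFS Q W b := by
  obtain ⟨t, h1, h2⟩ := h
  exact ⟨t, fun x => (h1 x).trans (hPQ x), h2.trans hab⟩

lemma HasFS.empty {P : ι → Prop} {W : ι → R} (h : ∀ x, ¬ P x) : HasFS P W 0 :=
  ⟨∅, fun x => by simp [h x], by simp⟩

lemma HasFS.single (W : ι → R) (x0 : ι) : HasFS (fun x => x = x0) W (W x0) :=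
  ⟨{x0}, fun x => by simp, by simp⟩

lemma HasFS.or {P Q : ι → Prop} {W : ι → R} {a b : R} (h1 : HasFS P W a) (h2 : HasFS Q W b)
    (hd : ∀ x, P x → Q x → False) : HasFS (fun x => P x ∨ Q x) W (a + b) := by
  obtain ⟨t, ht, rfl⟩ := h1
  obtain ⟨u, hu, rfl⟩ := h2
  refine ⟨t ∪ u, fun x => by rw [Finset.mem_union, ht, hu], Finset.sum_union ?_⟩
  rw [Finset.disjoint_left]
  intro x hx hx'
  exact hd x ((ht x).1 hx) ((hu x).1 hx')

lemma HasFS.ex {P : κ → ι → Prop} {W : ι → R} {a : κ → R} (I : Finset κ)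
    (h : ∀ i ∈ I, HasFS (P i) W (a i)) (hd : ∀ i ∈ I, ∀ j ∈ I, ∀ x, P i x → P j x → i = j) :
    HasFS (fun x => ∃ i ∈ I, P i x) W (∑ i ∈ I, a i) := by
  choose! t ht hs using h
  refine ⟨I.biUnion t, fun x => ?_, ?_⟩
  · rw [Finset.mem_biUnion]
    exact exists_congr fun i => and_congr_right fun hi => ht i hi x
  · rw [Finset.sum_biUnion]
    · exact Finset.sum_congr rfl hs
    · intro i hi j hj hij
      rw [Function.onFun, Finset.disjoint_left]
      intro x hx hx'
      exact hij (hd i hi j hj x ((ht i hi x).1 hx) ((ht j hj x).1 hx'))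

lemma HasFS.mul {P : ι → Prop} {V W : ι → R} {a : R} (h : HasFS P V a) (k : R)
    (hW : ∀ x, P x → W x = k * V x) : HasFS P W (k * a) := by
  obtain ⟨t, ht, rfl⟩ := h
  refine ⟨t, ht, ?_⟩
  rw [Finset.mul_sum]
  exact Finset.sum_congr rfl fun x hx => hW x ((ht x).1 hx)

lemma HasFS.map {P : ι → Prop} {V : ι → R} {W : κ → R} {a : R} (h : HasFS P V a) (k : R)
    (e : ι → κ) (he : Function.Injective e) (hW : ∀ x, P x → W (e x) = k * V x) :
    HasFS (fun y => ∃ x, P x ∧ y = e x) W (k * a) := by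
  obtain ⟨t, ht, rfl⟩ := h
  refine ⟨t.image e, fun y => ?_, ?_⟩
  · rw [Finset.mem_image]
    exact exists_congr fun x => and_congr (ht x) eq_comm
  · rw [Finset.sum_image fun x _ y _ h => he h, Finset.mul_sum]
    exact Finset.sum_congr rfl fun x hx => hW x ((ht x).1 hx)

end HasFS

/-- total number of cells of a word -/
def wsize (l : List (Finset ℕ)) : ℕ := (l.map Finset.card).sum

/-- admissible continuations of a partially read run -/
structure YP (S : Set ℤ) (G : Option (Finset ℕ)) (pre : Finset ℕ) (c N : ℕ)
    (p : Finset ℕ × List (Finset ℕ)) : Prop where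
  sub : pre ⊆ p.1
  seg : ∀ h ∈ p.1, h ∈ pre ∨ c < h
  rel : ∀ g ∈ G, Rel S (up g) (up p.1)
  runs : Runs S (p.1 :: p.2)
  size : p.1.card + wsize p.2 < pre.card + N

noncomputable def lam (S : Set ℤ) (k : ℕ) (p : Finset ℕ × List (Finset ℕ)) :
    PowerSeries (Polynomial ℚ) :=
  (if p.1.card = 1 then w1 S else Useries * (Eexp - 1) ^ (p.1.card - k + 1)) * wordW S p.2

noncomputable def kindA {m : ℕ} (σ : AState m) : Fin 3 :=
  if σ.cc ∧ σ.sat then (if σ.single then 1 else 2) else 0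

lemma runs_cons {S : Set ℤ} {H : Finset ℕ} {l : List (Finset ℕ)} :
    Runs S (H :: l) ↔ (H.Nonempty ∧ CutConn S (up H)) ∧ (∀ H' ∈ l.head?, RelM S H H') ∧ Runs S l := by
  unfold Runs
  rw [List.isChain_cons, List.forall_mem_cons]
  tauto

lemma lam_one (S : Set ℤ) (p : Finset ℕ × List (Finset ℕ)) (hp : p.1.Nonempty) :
    lam S 1 p = wordW S (p.1 :: p.2) := by
  unfold lam wordW
  rw [List.map_cons, List.prod_cons, wt]
  have := Finset.card_pos.2 hp
  rw [Nat.sub_add_cancel this]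

theorem automaton {S : Set ℤ} (hS : Good S) {m : ℕ} (hm : ∀ s ∈ S, s ≤ m) (N : ℕ) :
    ∀ (G : Option (Finset ℕ)) (pre : Finset ℕ) (c : ℕ), c ∈ pre → (∀ a ∈ pre, a ≤ c) →
    (∀ g ∈ G, ∀ a ∈ g, a ≤ c) →
    HasFS (YP S G pre c N) (lam S pre.card)
      (ysys m (nwA S) (trA S) (s0A S m) (fun σ => outA S (kindA σ)) (Eexp - 1) N (piA S m G pre c) c) := by
  induction N with
  | zero =>
    intro G pre c hc hmax hG
    rw [ysys]
    apply HasFS.empty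
    intro p hp
    have h1 := hp.size
    have h2 := Finset.card_le_card hp.sub
    omega
  | succ N ih =>
    intro G pre c hc hmax hG
    rw [ysys]
    have hcard : 0 < pre.card := Finset.card_pos.2 ⟨c, hc⟩
    have hnot : ∀ δ, 1 ≤ δ → c + δ ∉ pre := fun δ hδ h => by have := hmax _ h; omega
    -- continuation of the current run
    have hQ : HasFS (fun p => ∃ δ ∈ Finset.Ico 1 (m + 1), YP S G (insert (c + δ) pre) (c + δ) N p)
        (lam S pre.card) ((Eexp - 1) * ∑ δ ∈ Finset.Ico 1 (m + 1),
          ysys m (nwA S) (trA S) (s0A S m) (fun σ => outA S (kindA σ)) (Eexp - 1) N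
            (trA S (piA S m G pre c) δ) (c + δ)) := by
      have hQ' : HasFS (fun p => ∃ δ ∈ Finset.Ico 1 (m + 1), YP S G (insert (c + δ) pre) (c + δ) N p)
          (lam S (pre.card + 1)) (∑ δ ∈ Finset.Ico 1 (m + 1),
            ysys m (nwA S) (trA S) (s0A S m) (fun σ => outA S (kindA σ)) (Eexp - 1) N
              (trA S (piA S m G pre c) δ) (c + δ)) := by
        apply HasFS.ex
        · intro δ hδ
          rw [Finset.mem_Ico] at hδ
          have h1 := ih G (insert (c + δ) pre) (c + δ) (Finset.mem_insert_self _ _) (by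
            intro a ha
            rcases Finset.mem_insert.1 ha with rfl | ha
            · exact le_rfl
            · have := hmax a ha; omega) (fun g hg a ha => by have := hG g hg a ha; omega)
          rw [piA_tr hS hm G pre c hc hmax hG δ hδ.2 hδ.1,
            Finset.card_insert_of_notMem (hnot δ hδ.1)] at h1
          exact h1
        · have aux : ∀ i ∈ Finset.Ico 1 (m + 1), ∀ j ∈ Finset.Ico 1 (m + 1), ∀ p,
              YP S G (insert (c + i) pre) (c + i) N p → YP S G (insert (c + j) pre) (c + j) N p → j ≤ i := by
            intro i hi j hj p hp hp'
            rw [Finset.mem_Ico] at hi hj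
            rcases hp'.seg (c + i) (hp.sub (Finset.mem_insert_self _ _)) with h | h
            · rcases Finset.mem_insert.1 h with h | h
              · omega
              · exact absurd h (hnot i hi.1)
            · omega
          intro i hi j hj p hp hp'
          exact le_antisymm (aux j hj i hi p hp' hp) (aux i hi j hj p hp hp')
      refine hQ'.mul _ ?_
      rintro p ⟨δ, hδ, hp⟩
      rw [Finset.mem_Ico] at hδ
      have h1 := Finset.card_le_card hp.sub
      rw [Finset.card_insert_of_notMem (hnot δ hδ.1)] at h1
      unfold lam
      rw [if_neg (by omega), if_neg (by omega),
        show p.1.card - pre.card + 1 = (p.1.card - (pre.card + 1) + 1) + 1 by omega, pow_succ]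
      ring
    have hQiff : ∀ p, (YP S G pre c (N + 1) p ∧ p.1 ≠ pre) ↔
        ∃ δ ∈ Finset.Ico 1 (m + 1), YP S G (insert (c + δ) pre) (c + δ) N p := by
      intro p
      constructor
      · rintro ⟨hp, hne⟩
        have hex : ∃ h, h ∈ p.1 ∧ h ∉ pre := by
          by_contra hcon
          push Not at hcon
          exact hne (Finset.Subset.antisymm hcon hp.sub)
        obtain ⟨h1, h2⟩ := Nat.find_spec hex
        set e := Nat.find hex with he
        have hce : c < e := (hp.seg e h1).resolve_left h2
        have hmin : ∀ h ∈ p.1, h ∉ pre → e ≤ h := fun h hh hh' => Nat.find_min' hex ⟨hh, hh'⟩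
        have hce' : c + (e - c) = e := by omega
        refine ⟨e - c, ?_, ?_⟩
        · rw [Finset.mem_Ico]
          refine ⟨by omega, ?_⟩
          have hcc := (hp.runs.1 p.1 (by simp)).2
          obtain ⟨_, ⟨a, ha, rfl⟩, _, ⟨b, hb, rfl⟩, h3, h4, h5⟩ := hcc c
            ⟨c, mem_up.2 (hp.sub hc), le_rfl⟩ ⟨e, mem_up.2 h1, by exact_mod_cast hce⟩
          have h6 := hm _ h5
          have h7 : b ∉ pre := fun h => by have := hmax b h; omega
          have := hmin b hb h7
          omega
        · rw [hce']
          refine ⟨?_, ?_, hp.rel, hp.runs, ?_⟩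
          · intro a ha
            rcases Finset.mem_insert.1 ha with rfl | ha
            · exact h1
            · exact hp.sub ha
          · intro h hh
            by_cases hpre : h ∈ pre
            · exact Or.inl (Finset.mem_insert_of_mem hpre)
            · rcases (hmin h hh hpre).lt_or_eq with h8 | h8
              · exact Or.inr h8
              · exact Or.inl (h8 ▸ Finset.mem_insert_self _ _)
          · rw [Finset.card_insert_of_notMem h2]
            have := hp.size
            omega
      · rintro ⟨δ, hδ, hp⟩
        rw [Finset.mem_Ico] at hδ
        refine ⟨⟨fun a ha => hp.sub (Finset.mem_insert_of_mem ha), ?_, hp.rel, hp.runs, ?_⟩, ?_⟩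
        · intro h hh
          rcases hp.seg h hh with h1 | h1
          · rcases Finset.mem_insert.1 h1 with h1 | h1
            · right; omega
            · exact Or.inl h1
          · right; omega
        · have := hp.size
          rw [Finset.card_insert_of_notMem (hnot δ hδ.1)] at this
          omega
        · intro h
          have h1 := hp.sub (Finset.mem_insert_self _ _)
          rw [h] at h1
          exact hnot δ hδ.1 h1
    by_cases hok : CutConn S (up pre) ∧ ∀ g ∈ G, Rel S (up g) (up pre)
    swap
    · have hk : kindA (piA S m G pre c) = 0 := if_neg hok
      refine hQ.congr (fun p => ?_) ?_
      · rw [← hQiff p]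
        refine ⟨fun h => h.1, fun h => ⟨h, fun he => hok ?_⟩⟩
        have h1 := h.runs.1 p.1 (by simp)
        rw [he] at h1
        exact ⟨h1.2, fun g hg => he ▸ h.rel g hg⟩
      · rw [hk]; simp [outA]
    -- the run is complete
    have hout : outA S (kindA (piA S m G pre c)) =
        if pre.card = 1 then w1 S else Useries * (Eexp - 1) := by
      have : kindA (piA S m G pre c) = if pre.card = 1 then 1 else 2 := by
        unfold kindA
        have hok' : (piA S m G pre c).cc ∧ (piA S m G pre c).sat := hok
        rw [if_pos hok']
        by_cases h : pre.card = 1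
        · have h' : (piA S m G pre c).single := h
          rw [if_pos h, if_pos h']
        · have h' : ¬ (piA S m G pre c).single := h
          rw [if_neg h, if_neg h']
      rw [this]
      split_ifs <;> rfl
    have hlam0 : ∀ l, lam S pre.card (pre, l) = outA S (kindA (piA S m G pre c)) * wordW S l := by
      intro l
      rw [hout, lam]
      simp
    have hb1 : HasFS (fun p => ∃ b ∈ Finset.range c, YP S none {b} b N p) (lam S 1)
        (∑ b ∈ Finset.range c, ysys m (nwA S) (trA S) (s0A S m) (fun σ => outA S (kindA σ)) (Eexp - 1) N
            (s0A S m) b) := by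
      apply HasFS.ex
      · intro b _
        have h1 := ih none {b} b (Finset.mem_singleton_self _)
          (fun a ha => (Finset.mem_singleton.1 ha).le) (by simp)
        rwa [piA_none, Finset.card_singleton] at h1
      · intro i _ j _ p hp hp'
        have h1 := hp'.seg i (hp.sub (Finset.mem_singleton_self _))
        have h2 := hp.seg j (hp'.sub (Finset.mem_singleton_self _))
        rw [Finset.mem_singleton] at h1 h2
        omega
    have hb2 : HasFS (fun p => ∃ δ ∈ Finset.range (m + 1), YP S (some pre) {c + δ} (c + δ) N p) (lam S 1)
        (∑ δ ∈ Finset.range (m + 1), ysys m (nwA S) (trA S) (s0A S m) (fun σ => outA S (kindA σ)) (Eexp - 1) N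
            (nwA S (piA S m G pre c) δ) (c + δ)) := by
      apply HasFS.ex
      · intro δ hδ
        have h1 := ih (some pre) {c + δ} (c + δ) (Finset.mem_singleton_self _)
          (fun a ha => (Finset.mem_singleton.1 ha).le) (by
            intro g hg a ha
            rw [Option.mem_some_iff] at hg
            subst hg
            have := hmax a ha
            omega)
        rwa [piA_new hS hm G pre c hmax δ (Finset.mem_range.1 hδ), Finset.card_singleton] at h1
      · intro i _ j _ p hp hp'
        have h1 := hp'.seg _ (hp.sub (Finset.mem_singleton_self _))
        have h2 := hp.seg _ (hp'.sub (Finset.mem_singleton_self _))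
        rw [Finset.mem_singleton] at h1 h2
        omega
    have hb12 := hb1.or hb2 (by
      rintro p ⟨b, hb, hp⟩ ⟨δ, _, hp'⟩
      have h1 := hp'.seg _ (hp.sub (Finset.mem_singleton_self _))
      rw [Finset.mem_range] at hb
      rw [Finset.mem_singleton] at h1
      omega)
    have hb3 := hb12.map (W := lam S pre.card) (outA S (kindA (piA S m G pre c)))
      (fun q => ((pre, q.1 :: q.2) : Finset ℕ × List (Finset ℕ))) (by
        rintro ⟨a, b⟩ ⟨a', b'⟩ h
        simp only [Prod.mk.injEq, List.cons.injEq, true_and] at h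
        rw [h.1, h.2]) (by
        intro q hq
        have hne : q.1.Nonempty := by
          rcases hq with ⟨b, _, hq⟩ | ⟨b, _, hq⟩
          · exact ⟨_, hq.sub (Finset.mem_singleton_self _)⟩
          · exact ⟨_, hq.sub (Finset.mem_singleton_self _)⟩
        rw [hlam0, lam_one S q hne])
    have hb4 := (HasFS.single (lam S pre.card) ((pre, []) : Finset ℕ × List (Finset ℕ))).or hb3 (by
      rintro p rfl ⟨q, _, h⟩
      simp at h)
    have hb5 := hb4.or hQ (by
      intro p h1 h2
      have h3 := ((hQiff p).2 h2).2
      rcases h1 with rfl | ⟨q, _, rfl⟩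
      · exact h3 rfl
      · exact h3 rfl)
    refine hb5.congr (fun p => ?_) ?_
    · rw [← hQiff p]
      constructor
      · rintro ((rfl | ⟨q, hq, rfl⟩) | h)
        · refine ⟨Finset.Subset.refl _, fun h hh => Or.inl hh, hok.2, ?_, by simp [wsize]⟩
          rw [runs_cons]
          exact ⟨⟨⟨c, hc⟩, hok.1⟩, by simp, by simp [Runs]⟩
        · have key : RelM S pre q.1 ∧ Runs S (q.1 :: q.2) ∧ q.1.card + wsize q.2 < 1 + N := by
            rcases hq with ⟨b, hb, hq⟩ | ⟨δ, _, hq⟩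
            · refine ⟨Or.inl ⟨c, hc, b, hq.sub (Finset.mem_singleton_self _), Finset.mem_range.1 hb⟩,
                hq.runs, ?_⟩
              have := hq.size
              rwa [Finset.card_singleton] at this
            · refine ⟨Or.inr (hq.rel pre rfl), hq.runs, ?_⟩
              have := hq.size
              rwa [Finset.card_singleton] at this
          obtain ⟨k1, k2, k3⟩ := key
          refine ⟨Finset.Subset.refl _, fun h hh => Or.inl hh, hok.2, ?_, ?_⟩
          · rw [runs_cons]
            refine ⟨⟨⟨c, hc⟩, hok.1⟩, ?_, k2⟩
            intro H' hH'
            simp only [List.head?_cons, Option.mem_some_iff] at hH'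
            rw [← hH']; exact k1
          · have : wsize (q.1 :: q.2) = q.1.card + wsize q.2 := by simp [wsize]
            show pre.card + wsize (q.1 :: q.2) < _
            omega
        · exact h.1
      · intro hp
        by_cases he : p.1 = pre
        · left
          obtain ⟨H, l⟩ := p
          have he' : H = pre := he
          subst he'
          cases l with
          | nil => exact Or.inl rfl
          | cons H' l' =>
            right
            refine ⟨(H', l'), ?_, rfl⟩
            have hr := hp.runs
            rw [runs_cons] at hr
            obtain ⟨_, hr1, hr2⟩ := hr
            have hrel : RelM S H H' := hr1 H' (by simp)
            have hne : H'.Nonempty := (hr2.1 H' (by simp)).1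
            have hsize : H'.card + wsize l' < 1 + N := by
              have h1 := hp.size
              have : wsize (H' :: l') = H'.card + wsize l' := by simp [wsize]
              simp only [this] at h1
              omega
            set b := H'.min' hne with hb
            have hbm : b ∈ H' := Finset.min'_mem _ _
            have hbmin : ∀ h ∈ H', b ≤ h := fun h hh => Finset.min'_le _ _ hh
            have hsub : {b} ⊆ H' := by
              intro a ha
              rw [Finset.mem_singleton.1 ha]; exact hbm
            have hseg : ∀ h ∈ H', h ∈ ({b} : Finset ℕ) ∨ b < h := by
              intro h hh
              rcases (hbmin h hh).lt_or_eq with h1 | h1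
              · exact Or.inr h1
              · exact Or.inl (by rw [Finset.mem_singleton, h1])
            rcases Nat.lt_or_ge b c with hbc | hbc
            · left
              exact ⟨b, Finset.mem_range.2 hbc, hsub, hseg, by simp, hr2, by
                rw [Finset.card_singleton]; exact hsize⟩
            · right
              have hR : Rel S (up H) (up H') := by
                rcases hrel with ⟨h, hh, h', hh', hlt⟩ | hrel
                · have := hmax h hh
                  have := hbmin h' hh'
                  omega
                · exact hrel
              have hbc' : c + (b - c) = b := by omega
              refine ⟨b - c, ?_, ?_⟩
              · obtain ⟨_, ⟨u, hu, rfl⟩, _, ⟨v, hv, rfl⟩, h1⟩ := hR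
                have h2 := hm _ (hS.sym' h1)
                have := hmax u hu
                have := hbmin v hv
                rw [Finset.mem_range]
                omega
              · rw [hbc']
                refine ⟨hsub, hseg, ?_, hr2, by rw [Finset.card_singleton]; exact hsize⟩
                intro g hg
                rw [Option.mem_some_iff] at hg
                rw [← hg]; exact hR
        · right
          exact ⟨hp, he⟩
    · rw [hlam0]
      simp only [wordW, List.map_nil, List.prod_nil]
      ring

lemma wsize_eq (l : List (Finset ℕ)) : wsize l = ∑ τ ∈ Finset.range l.length, (run l τ).card := by
  induction l with
  | nil => simp [wsize]
  | cons H l ih =>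
    rw [List.length_cons, Finset.sum_range_succ']
    simp only [wsize, List.map_cons, List.sum_cons] at ih ⊢
    rw [ih, add_comm]
    rfl

lemma wsize_le {l : List (Finset ℕ)} {n : ℕ} {f : Fin n → ℕ × ℕ} (hf : Realises f l) : wsize l ≤ n := by
  have h1 : wsize l = (elts l).card := by
    rw [wsize_eq, Finset.card_eq_sum_ones,
      Finset.sum_finset_product (elts l) (Finset.range l.length) (run l) (mem_elts l)]
    simp
  have h2 : elts l ⊆ Finset.univ.image f := by
    intro p hp
    rw [mem_elts'] at hp
    obtain ⟨i, hi⟩ := (hf p.1 p.2).2 hp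
    exact Finset.mem_image.2 ⟨i, Finset.mem_univ _, hi⟩
  calc wsize l = (elts l).card := h1
    _ ≤ (Finset.univ.image f).card := Finset.card_le_card h2
    _ ≤ (Finset.univ : Finset (Fin n)).card := Finset.card_image_le
    _ = n := by simp

lemma normal_words {S : Set ℤ} (hS : Good S) {m : ℕ} (hm : ∀ s ∈ S, s ≤ m) (N : ℕ) :
    HasFS (fun l => Normal S l ∧ wsize l ≤ N) (wordW S)
      (1 + ysys m (nwA S) (trA S) (s0A S m) (fun σ => outA S (kindA σ)) (Eexp - 1) N (s0A S m) 0) := by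
  have h1 := automaton hS hm N none {0} 0 (Finset.mem_singleton_self _)
    (fun a ha => (Finset.mem_singleton.1 ha).le) (by simp)
  rw [piA_none, Finset.card_singleton] at h1
  have h2 := h1.map (W := wordW S) 1 (fun p => p.1 :: p.2) (by
    rintro ⟨a, b⟩ ⟨a', b'⟩ h
    simp only [List.cons.injEq] at h
    rw [h.1, h.2]) (by
    intro p hp
    rw [one_mul, lam_one S p ⟨0, hp.sub (Finset.mem_singleton_self _)⟩])
  have h3 := (HasFS.single (wordW S) ([] : List (Finset ℕ))).or h2 (by
    rintro l rfl ⟨q, _, h⟩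
    simp at h)
  refine h3.congr (fun l => ?_) (by simp [wordW])
  constructor
  · rintro (rfl | ⟨p, hp, rfl⟩)
    · exact ⟨⟨⟨by simp, by simp⟩, by simp⟩, by simp [wsize]⟩
    · refine ⟨⟨hp.runs, ?_⟩, ?_⟩
      · intro H hH
        simp only [List.head?_cons, Option.mem_some_iff] at hH
        rw [← hH]
        exact hp.sub (Finset.mem_singleton_self _)
      · have := hp.size
        rw [Finset.card_singleton] at this
        have h4 : wsize (p.1 :: p.2) = p.1.card + wsize p.2 := by simp [wsize]
        omega
  · rintro ⟨hl, hs⟩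
    cases l with
    | nil => exact Or.inl rfl
    | cons H l =>
      right
      refine ⟨(H, l), ?_, rfl⟩
      have h0 : 0 ∈ H := hl.2 H (by simp)
      have h4 : wsize (H :: l) = H.card + wsize l := by simp [wsize]
      refine ⟨?_, ?_, by simp, hl.1, ?_⟩
      · intro a ha
        rw [Finset.mem_singleton.1 ha]; exact h0
      · intro h _
        rw [Finset.mem_singleton]
        exact Nat.eq_zero_or_pos h
      · rw [Finset.card_singleton]
        show H.card + wsize l < _
        omega

lemma dimf_le (S : Set ℤ) (l : List (Finset ℕ)) {n : ℕ} (f : Fin n → ℕ × ℕ) : dimf S l f ≤ n := by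
  unfold dimf
  exact Finset.card_image_le.trans (by simp)

theorem coeff_FGF {S : Set ℤ} (hS : Good S) (hfin : S.Finite) {m : ℕ} (hm : ∀ s ∈ S, s ≤ m) (N n : ℕ)
    (hn : n < N) : PowerSeries.coeff n (FGF S) = PowerSeries.coeff n
      (1 + ysys m (nwA S) (trA S) (s0A S m) (fun σ => outA S (kindA σ)) (Eexp - 1) N (s0A S m) 0) := by
  obtain ⟨L, hL, hsum⟩ := normal_words hS hm N
  rw [← hsum]
  let D : Finset (Σ _ : List (Finset ℕ), (Fin n → ℕ × ℕ)) := L.sigma fun l => realisers l n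
  have hD : ∀ l f, (⟨l, f⟩ : Σ _ : List (Finset ℕ), (Fin n → ℕ × ℕ)) ∈ D ↔ Normal S l ∧ Realises f l := by
    intro l f
    rw [Finset.mem_sigma, hL, mem_realisers]
    constructor
    · rintro ⟨⟨h1, _⟩, h2⟩; exact ⟨h1, h2⟩
    · rintro ⟨h1, h2⟩; exact ⟨⟨h1, (wsize_le h2).trans hn.le⟩, h2⟩
  have hcount : ∀ k, faceCount S n k = (D.filter fun p => dimf S p.1 p.2 = k).card := by
    intro k
    unfold faceCount
    rw [← Fintype.card_coe, ← Nat.card_eq_fintype_card]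
    symm
    apply Nat.card_congr
    refine Equiv.ofBijective (fun p => ⟨{y | SEq S y (pos p.1.1 p.1.2)}, ?_⟩) ⟨?_, ?_⟩
    · obtain ⟨⟨l, f⟩, hp⟩ := p
      rw [Finset.mem_filter, hD] at hp
      exact ⟨(isFace_iff hS _).2 ⟨_, rfl⟩, (faceDim_eq hS hfin hp.1.1 f hp.1.2).trans hp.2⟩
    · rintro ⟨⟨l, f⟩, hp⟩ ⟨⟨l', f'⟩, hp'⟩ h
      rw [Finset.mem_filter, hD] at hp hp'
      have h1 : ({y | SEq S y (pos l f)} : Set (Fin n → ℝ)) = {y | SEq S y (pos l' f')} :=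
        congrArg Subtype.val h
      have h2 : pos l f ∈ ({y | SEq S y (pos l f)} : Set (Fin n → ℝ)) := fun _ _ _ _ => Iff.rfl
      rw [h1] at h2
      have h3 : f = f' := normal_inj hS hp.1.1 hp'.1.1 f f' hp.1.2 hp'.1.2 h2
      subst h3
      have h4 : l = l' := realises_unique hp.1.1.1 hp'.1.1.1 hp.1.2 hp'.1.2
      subst h4
      rfl
    · rintro ⟨F, hF, hdim⟩
      obtain ⟨x, rfl⟩ := (isFace_iff hS F).1 hF
      obtain ⟨l, hl, f, hf, hx⟩ := normal_surj hS x
      have he : ({y | SEq S y (pos l f)} : Set (Fin n → ℝ)) = {y | SEq S y x} := by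
        ext y
        constructor
        · intro h a b s hs
          exact (h a b s hs).trans (hx a b s hs)
        · intro h a b s hs
          exact (h a b s hs).trans (hx a b s hs).symm
      refine ⟨⟨⟨l, f⟩, ?_⟩, Subtype.ext he⟩
      rw [Finset.mem_filter, hD]
      refine ⟨⟨hl, hf⟩, ?_⟩
      rw [← hdim, ← he]
      exact (faceDim_eq hS hfin hl f hf).symm
  have hmain : ∑ k ∈ Finset.range (n + 1), (faceCount S n k : ℚ) • (Polynomial.X : Polynomial ℚ) ^ k =
      ∑ p ∈ D, (Polynomial.X : Polynomial ℚ) ^ dimf S p.1 p.2 := by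
    rw [← Finset.sum_fiberwise_of_maps_to (s := D) (t := Finset.range (n + 1))
      (g := fun p => dimf S p.1 p.2) (fun p _ => Finset.mem_range.2 (Nat.lt_succ_of_le (dimf_le S p.1 p.2)))]
    refine Finset.sum_congr rfl fun k _ => ?_
    rw [hcount k, Finset.sum_congr rfl (g := fun _ => (Polynomial.X : Polynomial ℚ) ^ k)
      (fun p hp => by rw [(Finset.mem_filter.1 hp).2]), Finset.sum_const, Nat.cast_smul_eq_nsmul]
  rw [FGF, PowerSeries.coeff_mk, hmain, Finset.sum_sigma, map_sum, Finset.mul_sum]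
  refine Finset.sum_congr rfl fun l hl => ?_
  rw [sum_realisers S l n ((hL l).1 hl).1.1.run_nonempty, ← mul_assoc, ← Polynomial.C_mul,
    inv_mul_cancel₀ (by exact_mod_cast n.factorial_ne_zero), Polynomial.C_1, one_mul]

theorem face_gf_aux (S : Set ℤ) (hfin : S.Finite) (hne : S.Nonempty)
    (hsym : ∀ s : ℤ, s ∈ S ↔ -s ∈ S)
    (hclosed : ∀ s t : ℕ, (s : ℤ) ∉ S → (t : ℤ) ∉ S → ((s : ℤ) + (t : ℤ)) ∉ S) :
    ((0 : ℤ) ∈ S →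
      ∃ P : MvPolynomial (Fin 3) ℚ, P ≠ 0 ∧
        MvPolynomial.aeval ![FGF S, Eexp, Useries] P = 0 ∧
        (∀ G : PowerSeries (Polynomial ℚ),
          MvPolynomial.aeval ![G, Eexp, Useries] P = 0 → G = FGF S) ∧
        ∃ Fhat : PowerSeries (Polynomial ℚ),
          (∃ Q : MvPolynomial (Fin 3) ℚ, Q ≠ 0 ∧
            MvPolynomial.aeval ![Fhat, PowerSeries.X, Useries] Q = 0) ∧
          FGF S = compPS Fhat (Eexp - 1)) ∧
    ((0 : ℤ) ∉ S →
      ∃ P : MvPolynomial (Fin 4) ℚ, P ≠ 0 ∧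
        MvPolynomial.aeval ![FGF S, Eexu, Eexp, Useries] P = 0 ∧
        ∀ G : PowerSeries (Polynomial ℚ),
          MvPolynomial.aeval ![G, Eexu, Eexp, Useries] P = 0 → G = FGF S) := by
  have hS : Good S := by
    refine ⟨fun s hs => (hsym s).1 hs, fun s t hs ht hst => ?_⟩
    by_contra hcon
    push Not at hcon
    obtain ⟨a, rfl⟩ := Int.eq_ofNat_of_zero_le hs
    obtain ⟨b, rfl⟩ := Int.eq_ofNat_of_zero_le ht
    exact hclosed a b hcon.1 hcon.2 hst
  obtain ⟨M, hM⟩ := hfin.bddAbove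
  have hm : ∀ s ∈ S, s ≤ (M.toNat : ℤ) := fun s hs => (hM hs).trans (Int.self_le_toNat M)
  exact final_algebra S M.toNat (nwA S) (trA S) (s0A S M.toNat) kindA
    (fun N n hn => coeff_FGF hS hfin hm N n hn)

/-- Theorem 5.7. Let `S ⊂ ℤ` be finite nonempty with `S = -S` and
`s+t ∉ S` for all `s,t ∈ ℕ∖S`. If `0 ∈ S`, there is a nonzero trivariate polynomial `P`
over `ℚ` with `P(F_S, e^x, u) = 0`, `F_S` being the unique power series solution, and
consequently `F_S(x,u) = F̂(e^x - 1, u)` for an algebraic power series `F̂`. If `0 ∉ S`,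
there is a nonzero four-variable polynomial `P` over `ℚ` with `P(F_S, e^{xu}, e^x, u) = 0`,
`F_S` being the unique power series solution. -/
theorem face_gf_algebraic (S : Set ℤ) (hfin : S.Finite) (hne : S.Nonempty)
    (hsym : ∀ s : ℤ, s ∈ S ↔ -s ∈ S)
    (hclosed : ∀ s t : ℕ, (s : ℤ) ∉ S → (t : ℤ) ∉ S → ((s : ℤ) + (t : ℤ)) ∉ S) :
    ((0 : ℤ) ∈ S →
      ∃ P : MvPolynomial (Fin 3) ℚ, P ≠ 0 ∧
        MvPolynomial.aeval ![FGF S, Eexp, Useries] P = 0 ∧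
        (∀ G : PowerSeries (Polynomial ℚ),
          MvPolynomial.aeval ![G, Eexp, Useries] P = 0 → G = FGF S) ∧
        ∃ Fhat : PowerSeries (Polynomial ℚ),
          (∃ Q : MvPolynomial (Fin 3) ℚ, Q ≠ 0 ∧
            MvPolynomial.aeval ![Fhat, PowerSeries.X, Useries] Q = 0) ∧
          FGF S = compPS Fhat (Eexp - 1)) ∧
    ((0 : ℤ) ∉ S →
      ∃ P : MvPolynomial (Fin 4) ℚ, P ≠ 0 ∧
        MvPolynomial.aeval ![FGF S, Eexu, Eexp, Useries] P = 0 ∧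
        ∀ G : PowerSeries (Polynomial ℚ),
          MvPolynomial.aeval ![G, Eexu, Eexp, Useries] P = 0 → G = FGF S) := by
  exact face_gf_aux S hfin hne hsym hclosed

end Braid
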